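/- arXiv:1004.3635 — 2 statements merged into one kernel-verified Lean document; each statement's English description precedes it below -/
import Mathlib

section
/- Every random context language can be generated by a limited random context grammar, i.e., one in which every production has the form (A→BC,Per,For), (A→B,Per,For), or (A→a,∅,∅) with A,B,C nonterminals and a a terminal, and every permitting set Per and forbidding set For is either empty or a singleton. -/
/-- Symbols: nonterminals `N` plus terminals `T`. -/
abbrev Symb (N T : Type) := N ⊕ T

/-- `alph w` is the set of symbols occurring in the string `w`. -/
def alph {α : Type} (w : List α) : Set α := {a | a ∈ w}

/-- A (nonerasing) random context grammar: finitely many productions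
`(A → x, Per, For)` with `A ∈ N`, `x ∈ (N ∪ T)⁺`, `Per, For ⊆ N`. -/
structure RCG (N T : Type) where
  rules : Set (N × List (Symb N T) × Set N × Set N)
  fin : rules.Finite
  ne : ∀ r ∈ rules, r.2.1 ≠ []
  start : N

/-- One derivation step of a random context grammar.  The flag `incl` tells whether
the rewritten symbol is included in the context check (`true`: conditions checked
against `alph (uAv)`; `false`: against `alph (uv)`). -/
def RCG.Step {N T : Type} (G : RCG N T) (incl : Bool)
    (s₁ s₂ : List (Symb N T)) : Prop :=
  ∃ A x Per For u v, (A, x, Per, For) ∈ G.rules ∧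
    s₁ = u ++ Sum.inl A :: v ∧ s₂ = u ++ x ++ v ∧
    (∀ B ∈ Per, Sum.inl B ∈ alph (if incl then s₁ else u ++ v)) ∧
    (∀ B ∈ For, Sum.inl B ∉ alph (if incl then s₁ else u ++ v))

/-- The language of a random context grammar (under the chosen derivation definition). -/
def RCG.Lang {N T : Type} (G : RCG N T) (incl : Bool) : Set (List T) :=
  {w | Relation.ReflTransGen (G.Step incl) [Sum.inl G.start] (w.map Sum.inr)}

/-- The family of random context languages over terminal alphabet `T`
(standard definition: rewritten symbol excluded from the context check). -/
def RC (T : Type) : Set (Set (List T)) :=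
  {L | ∃ (N : Type) (G : RCG N T), G.Lang false = L}

/-- A (nonerasing) semi-conditional grammar of degree (1,1): productions
`(A → x, Per, For)` with `Per, For ⊆ N ∪ T` of cardinality at most one. -/
structure SCG (N T : Type) where
  rules : Set (N × List (Symb N T) × Set (Symb N T) × Set (Symb N T))
  fin : rules.Finite
  ne : ∀ r ∈ rules, r.2.1 ≠ []
  per1 : ∀ r ∈ rules, r.2.2.1.Subsingleton
  for1 : ∀ r ∈ rules, r.2.2.2.Subsingleton
  start : N

/-- One derivation step of a semi-conditional grammar; `incl` as in `RCG.Step`. -/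
def SCG.Step {N T : Type} (G : SCG N T) (incl : Bool)
    (s₁ s₂ : List (Symb N T)) : Prop :=
  ∃ A x Per For u v, (A, x, Per, For) ∈ G.rules ∧
    s₁ = u ++ Sum.inl A :: v ∧ s₂ = u ++ x ++ v ∧
    Per ⊆ alph (if incl then s₁ else u ++ v) ∧
    (∀ a ∈ For, a ∉ alph (if incl then s₁ else u ++ v))

/-- The language of a semi-conditional grammar. -/
def SCG.Lang {N T : Type} (G : SCG N T) (incl : Bool) : Set (List T) :=
  {w | Relation.ReflTransGen (G.Step incl) [Sum.inl G.start] (w.map Sum.inr)}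

/-- The family SC(1,1): inclusive derivation definition (context `alph (uAv)`). -/
def SC11 (T : Type) : Set (Set (List T)) :=
  {L | ∃ (N : Type) (G : SCG N T), G.Lang true = L}

/-- The family SC'(1,1): exclusive derivation definition (context `alph (uv)`). -/
def SC11' (T : Type) : Set (Set (List T)) :=
  {L | ∃ (N : Type) (G : SCG N T), G.Lang false = L}


namespace RCLim

open Relation

lemma step_iff {N T : Type} (G : RCG N T) (s₁ s₂ : List (Symb N T)) :
    G.Step false s₁ s₂ ↔ ∃ A x Per For u v, (A, x, Per, For) ∈ G.rules ∧
    s₁ = u ++ Sum.inl A :: v ∧ s₂ = u ++ x ++ v ∧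
    (∀ B ∈ Per, Sum.inl B ∈ u ++ v) ∧ (∀ B ∈ For, Sum.inl B ∉ u ++ v) := by
  simp [RCG.Step, alph]

/-- Transfer of languages along an embedding of grammars. -/
lemma lang_embed {N₀ T₀ N T : Type} (G₀ : RCG N₀ T₀) (G : RCG N T) (h : N₀ → N) (g : T₀ → T)
    (hs : G.start = h G₀.start)
    (fwd : ∀ s t, G₀.Step false s t →
      G.Step false (s.map (Sum.map h g)) (t.map (Sum.map h g)))
    (bwd : ∀ s t', G.Step false (s.map (Sum.map h g)) t' →
      ∃ t, t' = t.map (Sum.map h g) ∧ G₀.Step false s t) :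
    G.Lang false = (List.map g) '' G₀.Lang false := by
  ext w
  constructor
  · intro hw
    have key : ∀ t', ReflTransGen (G.Step false) [Sum.inl G.start] t' →
        ∃ t, t' = t.map (Sum.map h g) ∧ ReflTransGen (G₀.Step false) [Sum.inl G₀.start] t := by
      intro t' ht
      induction ht with
      | refl => exact ⟨[Sum.inl G₀.start], by simp [hs], .refl⟩
      | tail _ hst ih =>
        obtain ⟨t, rfl, ht⟩ := ih
        obtain ⟨t₂, rfl, h2⟩ := bwd _ _ hst
        exact ⟨t₂, rfl, ht.tail h2⟩
    obtain ⟨t, ht, hd⟩ := key _ hw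
    have : ∃ w₀ : List T₀, t = w₀.map Sum.inr ∧ w = w₀.map g := by
      clear hd hw
      induction t generalizing w with
      | nil => exact ⟨[], by simpa using ht⟩
      | cons a t ih =>
        cases w with
        | nil => simp at ht
        | cons b w =>
          simp only [List.map_cons, List.cons.injEq] at ht
          obtain ⟨w₀, rfl, rfl⟩ := ih _ ht.2
          rcases a with a | a
          · simp at ht
          · simp only [Sum.map_inr, Sum.inr.injEq] at ht
            exact ⟨a :: w₀, by simp, by simp [ht.1]⟩
    obtain ⟨w₀, rfl, rfl⟩ := this
    exact ⟨w₀, hd, rfl⟩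
  · rintro ⟨w₀, hw, rfl⟩
    have := ReflTransGen.lift (p := G.Step false) (List.map (Sum.map h g)) fwd _ _ hw
    simpa [RCG.Lang, hs, Function.comp_def, Function.onFun] using this

lemma reduce {N T : Type} (G : RCG N T) :
    ∃ (N₀ T₀ : Type) (_ : Finite N₀) (_ : Finite T₀) (G₀ : RCG N₀ T₀) (g : T₀ → T),
      G.Lang false = (List.map g) '' G₀.Lang false := by
  classical
  let NS : Set N := {G.start} ∪ ⋃ r ∈ G.rules, ({r.1} ∪ Sum.inl ⁻¹' {a | a ∈ r.2.1})
  let TS : Set T := ⋃ r ∈ G.rules, (Sum.inr ⁻¹' {a | a ∈ r.2.1})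
  have hNS : NS.Finite := by
    refine (Set.finite_singleton _).union (G.fin.biUnion fun r _ => (Set.finite_singleton _).union ?_)
    exact (List.finite_toSet r.2.1).preimage Sum.inl_injective.injOn
  have hTS : TS.Finite :=
    G.fin.biUnion fun r _ => (List.finite_toSet r.2.1).preimage Sum.inr_injective.injOn
  have fN : Finite NS := hNS
  have fT : Finite TS := hTS
  let f : Symb NS TS → Symb N T := Sum.map Subtype.val Subtype.val
  have hf : Function.Injective f := Sum.map_injective.2 ⟨Subtype.val_injective, Subtype.val_injective⟩
  let R₀ : Set (NS × List (Symb NS TS) × Set NS × Set NS) :=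
    {r | ∃ For, (r.1.1, r.2.1.map f, Subtype.val '' r.2.2.1, For) ∈ G.rules ∧
      r.2.2.2 = Subtype.val ⁻¹' For}
  have hR : R₀.Finite := by
    have h1 : {x : List (Symb NS TS) | x.map f ∈ (fun r : N × List (Symb N T) × Set N × Set N => r.2.1) '' G.rules}.Finite :=
      (G.fin.image _).preimage (List.map_injective_iff.2 hf).injOn
    refine ((Set.finite_univ (α := NS)).prod (h1.prod (Set.finite_univ (α := Set NS × Set NS)))).subset ?_
    rintro ⟨A, x, P, F⟩ ⟨For, h, _⟩
    simp only [Set.mem_prod, Set.mem_univ, true_and, and_true]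
    exact ⟨_, h, rfl⟩
  let G₀ : RCG NS TS :=
    { rules := R₀, fin := hR
      ne := by
        rintro ⟨A, x, P, F⟩ ⟨For, h, _⟩ h0
        have := G.ne _ h
        simp_all
      start := ⟨G.start, by simp [NS]⟩ }
  refine ⟨NS, TS, fN, fT, G₀, Subtype.val, lang_embed G₀ G Subtype.val Subtype.val rfl ?_ ?_⟩
  · intro s t hst
    rw [step_iff] at hst ⊢
    obtain ⟨A, x, P, F, u, v, ⟨For, hr, hF⟩, rfl, rfl, hp, hf'⟩ := hst
    refine ⟨_, _, _, _, u.map f, v.map f, hr, by simp [f], by simp [f], ?_, ?_⟩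
    · rintro _ ⟨B, hB, rfl⟩
      rw [← List.map_append]
      exact List.mem_map.2 ⟨_, hp B hB, rfl⟩
    · intro B hB hm
      rw [← List.map_append] at hm
      obtain ⟨b, hb, hbe⟩ := List.mem_map.1 hm
      rcases b with b | b
      · simp only [f, Sum.map_inl, Sum.inl.injEq] at hbe
        refine hf' b ?_ hb
        dsimp only at hF
        rw [hF]; simpa [hbe] using hB
      · simp [f] at hbe
  · intro s t' hst
    rw [step_iff] at hst
    obtain ⟨A, x, P, F, u, v, hr, hs, rfl, hp, hf'⟩ := hst
    obtain ⟨u₀, v₁, rfl, rfl, h1⟩ := List.map_eq_append_iff.1 hs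
    obtain ⟨a, v₀, rfl, ha, rfl⟩ := List.map_eq_cons_iff.1 h1
    rcases a with A₀ | a
    swap
    · simp at ha
    simp only [Sum.map_inl, Sum.inl.injEq] at ha
    subst ha
    have hx : ∃ x₀, List.map f x₀ = x := by
      have : x ∈ Set.range (List.map f) := by
        rw [Set.range_list_map]
        rintro (b | b) hb
        · exact ⟨Sum.inl ⟨b, Or.inr (Set.mem_biUnion hr (Or.inr hb))⟩, rfl⟩
        · exact ⟨Sum.inr ⟨b, (Set.mem_biUnion hr hb)⟩, rfl⟩
      exact this
    obtain ⟨x₀, rfl⟩ := hx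
    have hP : Subtype.val '' (Subtype.val ⁻¹' P : Set NS) = P := by
      rw [Set.image_preimage_eq_iff]
      intro B hB
      have := hp B hB
      rw [← List.map_append] at this
      obtain ⟨b, hb, hbe⟩ := List.mem_map.1 this
      rcases b with b | b
      · simp only [Sum.map_inl, Sum.inl.injEq] at hbe
        exact ⟨b, hbe⟩
      · simp at hbe
    have hmem : ∀ B : NS, (Sum.inl B.1 ∈ u₀.map (Sum.map Subtype.val Subtype.val) ++ v₀.map (Sum.map (Subtype.val : NS → N) (Subtype.val : TS → T)))
        ↔ Sum.inl B ∈ u₀ ++ v₀ := by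
      intro B
      rw [← List.map_append]
      exact List.mem_map_of_injective hf (a := Sum.inl B)
    refine ⟨u₀ ++ x₀ ++ v₀, by simp [f], ?_⟩
    rw [step_iff]
    refine ⟨A₀, x₀, Subtype.val ⁻¹' P, Subtype.val ⁻¹' F, u₀, v₀, ⟨F, ?_, rfl⟩, rfl, rfl, ?_, ?_⟩
    · dsimp only; rw [hP]; exact hr
    · intro B hB; exact (hmem B).1 (hp _ hB)
    · intro B hB h; exact hf' _ hB ((hmem B).2 h)

/-- Relabelling terminals. -/
lemma relabel {N T₀ T : Type} (G₀ : RCG N T₀) (g : T₀ → T) :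
    ∃ G : RCG N T, G.Lang false = (List.map g) '' G₀.Lang false ∧
      G.rules = (fun r => (r.1, r.2.1.map (Sum.map id g), r.2.2)) '' G₀.rules := by
  refine ⟨⟨(fun r => (r.1, r.2.1.map (Sum.map id g), r.2.2)) '' G₀.rules, G₀.fin.image _, ?_,
    G₀.start⟩, ?_, rfl⟩
  · rintro _ ⟨r, hr, rfl⟩
    simpa using G₀.ne r hr
  have hmem : ∀ (B : N) (l : List (Symb N T₀)),
      Sum.inl B ∈ l.map (Sum.map id g) ↔ Sum.inl B ∈ l := by
    intro B l; simp
  refine lang_embed G₀ _ id g rfl ?_ ?_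
  · intro s t hst
    rw [step_iff] at hst ⊢
    obtain ⟨A, x, P, F, u, v, hr, rfl, rfl, hp, hf⟩ := hst
    refine ⟨A, _, P, F, u.map (Sum.map id g), v.map (Sum.map id g), ⟨_, hr, rfl⟩, by simp, by simp, ?_, ?_⟩
    · intro B hB; rw [← List.map_append, hmem]; exact hp B hB
    · intro B hB; rw [← List.map_append, hmem]; exact hf B hB
  · intro s t' hst
    rw [step_iff] at hst
    obtain ⟨A, x, P, F, u, v, ⟨⟨A', x', P', F'⟩, hr, he⟩, hs, rfl, hp, hf⟩ := hst
    simp only [Prod.mk.injEq] at he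
    obtain ⟨rfl, rfl, rfl, rfl⟩ := he
    obtain ⟨u₀, v₁, rfl, rfl, h1⟩ := List.map_eq_append_iff.1 hs
    obtain ⟨a, v₀, rfl, ha, rfl⟩ := List.map_eq_cons_iff.1 h1
    rcases a with A₀ | a
    swap
    · simp at ha
    simp only [Sum.map_inl, Sum.inl.injEq, id] at ha
    subst ha
    refine ⟨u₀ ++ x' ++ v₀, by simp, ?_⟩
    rw [step_iff]
    refine ⟨A₀, x', P', F', u₀, v₀, hr, rfl, rfl, ?_, ?_⟩
    · intro B hB; rw [← hmem, List.map_append]; exact hp B hB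
    · intro B hB; rw [← hmem, List.map_append]; exact hf B hB

section Construction

variable {N T : Type}

/-- States of the controller. -/
inductive Q (G : RCG N T) : Type where
  | idle : Q G
  | sel (r : G.rules) : Q G
  | chk (b : Bool) (r : G.rules) (c : Set N) : Q G
  | exp : Q G
  | last (y : Symb N T) : Q G

/-- Nonterminals of the limited grammar. -/
inductive NN (G : RCG N T) : Type where
  | plain (y : Symb N T) : NN G
  | head (y : Symb N T) (q : Q G) : NN G
  | mark (w : List (Symb N T)) : NN G

open NN Q

/-- Productions of the limited grammar. -/
inductive Rl (G : RCG N T) (K : ℕ) :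
    NN G → List (Symb (NN G) T) → Set (NN G) → Set (NN G) → Prop where
  | select (y : Symb N T) (r : G.rules) :
      Rl G K (head y idle) [Sum.inl (head y (sel r))] ∅ ∅
  | markit (y : Symb N T) (r : G.rules) :
      Rl G K (plain (Sum.inl r.1.1)) [Sum.inl (mark r.1.2.1)] {head y (sel r)} {mark r.1.2.1}
  | marked (y : Symb N T) (r : G.rules) :
      Rl G K (head y (sel r)) [Sum.inl (head y (chk true r ∅))] {mark r.1.2.1} ∅
  | self (r : G.rules) :
      Rl G K (head (Sum.inl r.1.1) idle) [Sum.inl (head (Sum.inl r.1.1) (chk false r ∅))] ∅ ∅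
  | check (y : Symb N T) (b : Bool) (r : G.rules) (c : Set N) (B : N)
      (h : ¬ (b = true ∧ y = Sum.inl B ∧ B ∈ r.1.2.2.2)) :
      Rl G K (head y (chk b r c)) [Sum.inl (head y (chk b r (insert B c)))]
        {n | n = plain (Sum.inl B) ∧ B ∈ r.1.2.2.1 ∧ ¬ (b = true ∧ y = Sum.inl B)}
        {n | n = plain (Sum.inl B) ∧ B ∈ r.1.2.2.2}
  | go (y : Symb N T) (r : G.rules) :
      Rl G K (head y (chk true r Set.univ)) [Sum.inl (head y exp)] ∅ ∅
  | goself1 (y z : Symb N T) (r : G.rules) (h : r.1.2.1 = [z]) :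
      Rl G K (head y (chk false r Set.univ)) [Sum.inl (head z idle)] ∅ ∅
  | goself2 (y z z' : Symb N T) (w : List (Symb N T)) (r : G.rules) (h : r.1.2.1 = z :: z' :: w) :
      Rl G K (head y (chk false r Set.univ)) [Sum.inl (head z exp), Sum.inl (mark (z' :: w))] ∅ ∅
  | expand (y z z' : Symb N T) (w : List (Symb N T)) (h : (z :: z' :: w).length ≤ K) :
      Rl G K (mark (z :: z' :: w)) [Sum.inl (plain z), Sum.inl (mark (z' :: w))] {head y exp} ∅
  | tolast (y z : Symb N T) :
      Rl G K (head y exp) [Sum.inl (head y (last z))] {mark [z]} ∅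
  | lastx (y z : Symb N T) :
      Rl G K (mark [z]) [Sum.inl (plain z)] {head y (last z)} ∅
  | toidle (y z : Symb N T) :
      Rl G K (head y (last z)) [Sum.inl (head y idle)] ∅ {mark [z]}
  | term (a : T) : Rl G K (plain (Sum.inr a)) [Sum.inr a] ∅ ∅
  | hterm (a : T) : Rl G K (head (Sum.inr a) idle) [Sum.inr a] ∅ ∅

lemma finite_Q (G : RCG N T) [Finite N] [Finite T] : Finite (Q G) := by
  have : Finite G.rules := G.fin
  let f : Unit ⊕ G.rules ⊕ (Bool × G.rules × Set N) ⊕ Unit ⊕ Symb N T → Q G := fun x =>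
    match x with
    | .inl _ => idle
    | .inr (.inl r) => sel r
    | .inr (.inr (.inl (b, r, c))) => chk b r c
    | .inr (.inr (.inr (.inl _))) => exp
    | .inr (.inr (.inr (.inr y))) => last y
  refine Finite.of_surjective f ?_
  rintro (_ | r | ⟨b, r, c⟩ | _ | y)
  · exact ⟨.inl (), rfl⟩
  · exact ⟨.inr (.inl r), rfl⟩
  · exact ⟨.inr (.inr (.inl (b, r, c))), rfl⟩
  · exact ⟨.inr (.inr (.inr (.inl ()))), rfl⟩
  · exact ⟨.inr (.inr (.inr (.inr y))), rfl⟩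

/-- The finitely many symbols used. -/
def F0 (G : RCG N T) (K : ℕ) : Set (NN G) :=
  Set.range plain ∪ Set.range (fun p : Symb N T × Q G => head p.1 p.2) ∪
    mark '' {w : List (Symb N T) | w.length ≤ K}

lemma finite_F0 (G : RCG N T) (K : ℕ) [Finite N] [Finite T] : (F0 G K).Finite := by
  have := finite_Q G
  exact ((Set.finite_range _).union (Set.finite_range _)).union
    ((List.finite_length_le (Symb N T) K).image _)

@[simp] lemma plain_F0 (G : RCG N T) (K : ℕ) (y) : plain y ∈ F0 G K := by simp [F0]
@[simp] lemma head_F0 (G : RCG N T) (K : ℕ) (y q) : head y q ∈ F0 G K := by simp [F0]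
@[simp] lemma mark_F0 (G : RCG N T) (K : ℕ) (w) : mark w ∈ F0 G K ↔ w.length ≤ K := by simp [F0]

lemma rl_spec (G : RCG N T) (K : ℕ) (hK : ∀ r ∈ G.rules, r.2.1.length ≤ K) (hK1 : 1 ≤ K)
    {A x P F} (h : Rl G K A x P F) :
    ((∃ B C, x = [Sum.inl B, Sum.inl C]) ∨ (∃ B, x = [Sum.inl B]) ∨
      (∃ a, x = [Sum.inr a] ∧ P = ∅ ∧ F = ∅)) ∧ P.Subsingleton ∧ F.Subsingleton ∧
    A ∈ F0 G K ∧ P ⊆ F0 G K ∧ F ⊆ F0 G K ∧ ∀ n, Sum.inl n ∈ x → n ∈ F0 G K := by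
  have hK' : ∀ r : G.rules, r.1.2.1.length ≤ K := fun r => hK _ r.2
  cases h with
  | check y b r c B h =>
    refine ⟨by simp, ?_, ?_, by simp, ?_, ?_, by simp⟩
    · rintro _ ⟨rfl, -⟩ _ ⟨rfl, -⟩; rfl
    · rintro _ ⟨rfl, -⟩ _ ⟨rfl, -⟩; rfl
    · rintro _ ⟨rfl, -⟩; simp
    · rintro _ ⟨rfl, -⟩; simp
  | goself2 y z z' w r h =>
    have := hK' r
    rw [h] at this
    simp at this ⊢
    omega
  | expand y z z' w h =>
    simp at h ⊢
    omega
  | _ => simp [hK', hK1]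

/-- The limited grammar. -/
def GG (G : RCG N T) [Finite N] [Finite T] (K : ℕ) (hK : ∀ r ∈ G.rules, r.2.1.length ≤ K)
    (hK1 : 1 ≤ K) : RCG (NN G) T where
  rules := {r | Rl G K r.1 r.2.1 r.2.2.1 r.2.2.2}
  fin := by
    have hF := finite_F0 G K
    have hS : (Sum.inl '' F0 G K ∪ Set.range Sum.inr : Set (Symb (NN G) T)).Finite :=
      (hF.image _).union (Set.finite_range _)
    have hL : {l : List (Symb (NN G) T) | l.length ≤ 2 ∧ ∀ a ∈ l, a ∈ (Sum.inl '' F0 G K ∪ Set.range Sum.inr : Set (Symb (NN G) T))}.Finite := by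
      have : Finite ↥(Sum.inl '' F0 G K ∪ Set.range Sum.inr : Set (Symb (NN G) T)) := hS
      refine ((List.finite_length_le ↥(Sum.inl '' F0 G K ∪ Set.range Sum.inr : Set (Symb (NN G) T)) 2).image (List.map Subtype.val)).subset ?_
      rintro l ⟨h1, h2⟩
      exact ⟨l.attach.map (fun a => ⟨a.1, h2 _ a.2⟩), by simpa using h1, by
        rw [List.map_map]; exact List.attach_map_subtype_val l⟩
    refine (hF.prod (hL.prod (hF.finite_subsets.prod hF.finite_subsets))).subset ?_
    rintro ⟨A, x, P, F⟩ h
    obtain ⟨h1, -, -, hA, hP, hFF, hx⟩ := rl_spec G K hK hK1 h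
    refine ⟨hA, ⟨?_, ?_⟩, hP, hFF⟩
    · rcases h1 with ⟨_, _, h⟩ | ⟨_, h⟩ | ⟨_, h, -⟩ <;> dsimp only at h ⊢ <;> simp [h]
    · rintro (a | a) ha
      · exact Or.inl ⟨a, hx a ha, rfl⟩
      · exact Or.inr ⟨a, rfl⟩
  ne := by
    rintro ⟨A, x, P, F⟩ h
    obtain ⟨h1, -⟩ := rl_spec G K hK hK1 h
    rcases h1 with ⟨_, _, h⟩ | ⟨_, h⟩ | ⟨_, h, -⟩ <;> dsimp only at h ⊢ <;> simp [h]
  start := head (Sum.inl G.start) idle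

/-- One step of the limited grammar. -/
def St (G : RCG N T) (K : ℕ) (s t : List (Symb (NN G) T)) : Prop :=
  ∃ A x P F u v, Rl G K A x P F ∧ s = u ++ Sum.inl A :: v ∧ t = u ++ x ++ v ∧
    (∀ B ∈ P, Sum.inl B ∈ u ++ v) ∧ (∀ B ∈ F, Sum.inl B ∉ u ++ v)

lemma GG_step (G : RCG N T) [Finite N] [Finite T] (K : ℕ) (hK hK1) :
    (GG G K hK hK1).Step false = St G K := by
  ext s t
  rw [step_iff]; rfl

/-! ### Completeness -/

lemma St.mk {G : RCG N T} {K : ℕ} {A x P F} (h : Rl G K A x P F) (u v : List (Symb (NN G) T))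
    (hP : ∀ B ∈ P, Sum.inl B ∈ u ++ v) (hF : ∀ B ∈ F, Sum.inl B ∉ u ++ v) :
    St G K (u ++ Sum.inl A :: v) (u ++ x ++ v) :=
  ⟨A, x, P, F, u, v, h, rfl, rfl, hP, hF⟩

/-- Plain encoding of a string. -/
def pl (G : RCG N T) (l : List (Symb N T)) : List (Symb (NN G) T) :=
  l.map (fun y => Sum.inl (plain y))

@[simp] lemma pl_append (G : RCG N T) (l m) : pl G (l ++ m) = pl G l ++ pl G m := by simp [pl]
@[simp] lemma pl_cons (G : RCG N T) (y l) : pl G (y :: l) = Sum.inl (plain y) :: pl G l := rfl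
@[simp] lemma pl_nil (G : RCG N T) : pl G [] = [] := rfl
@[simp] lemma plain_mem_pl (G : RCG N T) (y l) :
    (Sum.inl (plain y) : Symb (NN G) T) ∈ pl G l ↔ y ∈ l := by simp [pl]
@[simp] lemma mark_mem_pl (G : RCG N T) (y l) :
    ¬ (Sum.inl (mark y) : Symb (NN G) T) ∈ pl G l := by simp [pl]

lemma expand_lemma (G : RCG N T) (K : ℕ) (y : Symb N T) (v : List (Symb N T)) :
    ∀ (w : List (Symb N T)) (z : Symb N T) (u : List (Symb N T)), (z :: w).length ≤ K →
    ReflTransGen (St G K) (Sum.inl (head y exp) :: (pl G u ++ Sum.inl (mark (z :: w)) :: pl G v))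
      (Sum.inl (head y idle) :: pl G (u ++ z :: w ++ v)) := by
  intro w
  induction w with
  | nil =>
    intro z u _
    have h1 := St.mk (Rl.tolast (G := G) (K := K) y z) [] (pl G u ++ Sum.inl (mark [z]) :: pl G v)
      (by simp) (by simp)
    have h2 := St.mk (Rl.lastx (G := G) (K := K) y z) (Sum.inl (head y (last z)) :: pl G u) (pl G v)
      (by simp) (by simp)
    have h3 := St.mk (Rl.toidle (G := G) (K := K) y z) [] (pl G (u ++ z :: v))
      (by simp) (by simp)
    simp at h1 h2 h3 ⊢
    exact ((ReflTransGen.single h1).tail h2).tail h3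
  | cons z' w ih =>
    intro z u h
    have h1 := St.mk (Rl.expand (G := G) (K := K) y z z' w h) (Sum.inl (head y exp) :: pl G u) (pl G v)
      (by simp) (by simp)
    have h2 := ih z' (u ++ [z]) (by simp at h ⊢; omega)
    simp at h1 h2 ⊢
    exact ReflTransGen.head h1 h2

lemma check_lemma (G : RCG N T) (K : ℕ) [Finite N] (y : Symb N T) (b : Bool) (r : G.rules)
    (p : List (Symb (NN G) T))
    (hp : ∀ B ∈ r.1.2.2.1, Sum.inl (plain (Sum.inl B)) ∈ p ∨ (b = true ∧ y = Sum.inl B))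
    (hf : ∀ B ∈ r.1.2.2.2, Sum.inl (plain (Sum.inl B)) ∉ p ∧ ¬ (b = true ∧ y = Sum.inl B)) :
    ReflTransGen (St G K) (Sum.inl (head y (chk b r ∅)) :: p)
      (Sum.inl (head y (chk b r Set.univ)) :: p) := by
  have key : ∀ c : Set N, c.Finite → ReflTransGen (St G K) (Sum.inl (head y (chk b r ∅)) :: p)
      (Sum.inl (head y (chk b r c)) :: p) := by
    intro c hc
    induction c, hc using Set.Finite.induction_on with
    | empty => exact .refl
    | @insert B c _ _ ih =>
      refine ih.tail ?_
      refine St.mk (Rl.check (G := G) (K := K) y b r c B ?_) [] p ?_ ?_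
      · rintro ⟨h1, h2, h3⟩
        exact (hf B h3).2 ⟨h1, h2⟩
      · rintro _ ⟨rfl, h1, h2⟩
        exact (hp B h1).resolve_right h2
      · rintro _ ⟨rfl, h1⟩
        exact (hf B h1).1
  exact key _ Set.finite_univ

/-- Encoding with idle head. -/
def enc (G : RCG N T) : List (Symb N T) → List (Symb (NN G) T)
  | [] => []
  | y :: l => Sum.inl (head y idle) :: pl G l

lemma enc_step (G : RCG N T) (K : ℕ) [Finite N] (hK : ∀ r ∈ G.rules, r.2.1.length ≤ K)
    {s t : List (Symb N T)} (h : G.Step false s t) :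
    ReflTransGen (St G K) (enc G s) (enc G t) := by
  rw [step_iff] at h
  obtain ⟨A, x, P, F, u, v, hr, rfl, rfl, hp, hf⟩ := h
  have hx := G.ne _ hr
  have hxK := hK _ hr
  dsimp only at hx hxK
  cases u with
  | nil =>
    have h1 := St.mk (Rl.self (G := G) (K := K) ⟨_, hr⟩) [] (pl G v) (by simp) (by simp)
    have h2 := check_lemma G K (Sum.inl A) false ⟨_, hr⟩ (pl G v) (by simpa using hp)
      (by simpa using hf)
    refine ReflTransGen.trans (ReflTransGen.head h1 h2) ?_
    match x, hx, hxK, hr with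
    | [z], _, _, hr =>
      exact .single (St.mk (Rl.goself1 (G := G) (K := K) (Sum.inl A) z ⟨_, hr⟩ rfl) [] (pl G v)
        (by simp) (by simp))
    | z :: z' :: w, _, hxK, hr =>
      have h3 := St.mk (Rl.goself2 (G := G) (K := K) (Sum.inl A) z z' w ⟨_, hr⟩ rfl) [] (pl G v)
        (by simp) (by simp)
      have h4 := expand_lemma G K z v w z' [] (by simp at hxK ⊢; omega)
      exact ReflTransGen.head h3 h4
  | cons y u =>
    obtain ⟨z, w, rfl⟩ := List.exists_cons_of_ne_nil hx
    let r : G.rules := ⟨_, hr⟩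
    have h1 := St.mk (Rl.select (G := G) (K := K) y r) [] (pl G (u ++ Sum.inl A :: v))
      (by simp) (by simp)
    have h2 := St.mk (Rl.markit (G := G) (K := K) y r) (Sum.inl (head y (sel r)) :: pl G u) (pl G v)
      (by simp) (by simp)
    have h3 := St.mk (Rl.marked (G := G) (K := K) y r) []
      (pl G u ++ Sum.inl (mark (z :: w)) :: pl G v) (by simp [r]) (by simp)
    have h4 := check_lemma G K y true r (pl G u ++ Sum.inl (mark (z :: w)) :: pl G v)
      (by
        intro B hB
        have := hp B hB
        simp at this ⊢
        grind)
      (by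
        intro B hB
        have := hf B hB
        simp at this ⊢
        grind)
    have h5 := St.mk (Rl.go (G := G) (K := K) y r) []
      (pl G u ++ Sum.inl (mark (z :: w)) :: pl G v) (by simp) (by simp)
    have h6 := expand_lemma G K y v w z u hxK
    simp [r] at h1 h2 h3 h4 h5 h6 
    simp [enc]
    refine ReflTransGen.head h1 (ReflTransGen.head h2 (ReflTransGen.head h3 (h4.trans (ReflTransGen.head h5 h6))))

lemma term_lemma (G : RCG N T) (K : ℕ) (w : List T) : ∀ u : List T,
    ReflTransGen (St G K) (u.map Sum.inr ++ pl G (w.map Sum.inr)) ((u ++ w).map Sum.inr) := by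
  induction w with
  | nil => intro u; simp; exact .refl
  | cons a w ih =>
    intro u
    have h1 := St.mk (Rl.term (G := G) (K := K) a) (u.map Sum.inr) (pl G (w.map Sum.inr))
      (by simp) (by simp)
    have h2 := ih (u ++ [a])
    simp at h1 h2 ⊢
    exact ReflTransGen.head h1 h2

lemma complete (G : RCG N T) (K : ℕ) [Finite N] (hK : ∀ r ∈ G.rules, r.2.1.length ≤ K)
    (w : List T) (h : ReflTransGen (G.Step false) [Sum.inl G.start] (w.map Sum.inr)) :
    ReflTransGen (St G K) [Sum.inl (head (Sum.inl G.start) idle)] (w.map Sum.inr) := by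
  have key : ∀ s, ReflTransGen (G.Step false) [Sum.inl G.start] s →
      ReflTransGen (St G K) [Sum.inl (head (Sum.inl G.start) idle)] (enc G s) ∧ s ≠ [] := by
    intro s hs
    induction hs with
    | refl => exact ⟨.refl, by simp⟩
    | tail _ hst ih =>
      refine ⟨ih.1.trans (enc_step G K hK hst), ?_⟩
      rw [step_iff] at hst
      obtain ⟨A, x, P, F, u, v, hr, rfl, rfl, hp, hf⟩ := hst
      have := G.ne _ hr
      simp_all
  obtain ⟨h1, h2⟩ := key _ h
  cases w with
  | nil => simp at h2
  | cons a w =>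
    refine h1.trans ?_
    have h3 := St.mk (Rl.hterm (G := G) (K := K) a) [] (pl G (w.map Sum.inr)) (by simp) (by simp)
    have h4 := term_lemma G K w [a]
    exact ReflTransGen.head h3 h4

/-! ### Soundness -/

/-- Head occurrences. -/
def hd (G : RCG N T) : Symb (NN G) T → List (Symb N T × Q G)
  | .inl (head y q) => [(y, q)]
  | _ => []

/-- Mark occurrences. -/
def mk (G : RCG N T) : Symb (NN G) T → List (List (Symb N T))
  | .inl (mark w) => [w]
  | _ => []

/-- Projection of a symbol. -/
def pj (G : RCG N T) (η : Symb N T → List (Symb N T)) (μ : List (Symb N T) → List (Symb N T)) :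
    Symb (NN G) T → List (Symb N T)
  | .inl (plain y) => [y]
  | .inl (head y _) => η y
  | .inl (mark w) => μ w
  | .inr a => [.inr a]

/-- Head occurrences in a string. -/
def heads (G : RCG N T) (s : List (Symb (NN G) T)) := List.flatMap (hd G) s
/-- Mark occurrences in a string. -/
def marks (G : RCG N T) (s : List (Symb (NN G) T)) := List.flatMap (mk G) s
/-- Projection of a string. -/
def prj (G : RCG N T) (η : Symb N T → List (Symb N T)) (μ : List (Symb N T) → List (Symb N T))
    (s : List (Symb (NN G) T)) := List.flatMap (pj G η μ) s

@[simp] lemma heads_nil (G : RCG N T) : heads G [] = [] := rfl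
@[simp] lemma heads_cons (G : RCG N T) (a s) : heads G (a :: s) = hd G a ++ heads G s := rfl
@[simp] lemma heads_append (G : RCG N T) (s t) : heads G (s ++ t) = heads G s ++ heads G t :=
  List.flatMap_append
@[simp] lemma marks_nil (G : RCG N T) : marks G [] = [] := rfl
@[simp] lemma marks_cons (G : RCG N T) (a s) : marks G (a :: s) = mk G a ++ marks G s := rfl
@[simp] lemma marks_append (G : RCG N T) (s t) : marks G (s ++ t) = marks G s ++ marks G t :=
  List.flatMap_append
@[simp] lemma prj_nil (G : RCG N T) (η μ) : prj G η μ [] = [] := rfl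
@[simp] lemma prj_cons (G : RCG N T) (η μ a s) :
    prj G η μ (a :: s) = pj G η μ a ++ prj G η μ s := rfl
@[simp] lemma prj_append (G : RCG N T) (η μ s t) :
    prj G η μ (s ++ t) = prj G η μ s ++ prj G η μ t :=
  List.flatMap_append

/-- The letter itself, as a string. -/
def sg (y : Symb N T) : List (Symb N T) := [y]

/-- Nothing. -/
def em {α : Type} (_ : α) : List (Symb N T) := []

/-- The verified part of the context conditions. -/
def Cond (r : N × List (Symb N T) × Set N × Set N) (c : Set N) (l : List (Symb N T)) : Prop :=
  ∀ B ∈ c, (B ∈ r.2.2.1 → Sum.inl B ∈ l) ∧ (B ∈ r.2.2.2 → Sum.inl B ∉ l)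

/-- The invariant. -/
inductive Inv (G : RCG N T) (D : List (Symb N T) → Prop)
    (pr : (Symb N T → List (Symb N T)) → (List (Symb N T) → List (Symb N T)) → List (Symb N T)) :
    List (Symb N T × Q G) → List (List (Symb N T)) → Prop where
  | fin (h : D (pr sg id)) : Inv G D pr [] []
  | idle (y) (h : D (pr sg id)) : Inv G D pr [(y, Q.idle)] []
  | sel0 (y r) (h : D (pr sg id)) : Inv G D pr [(y, Q.sel r)] []
  | sel1 (y) (r : G.rules) (h : D (pr sg (fun _ => [Sum.inl r.1.1]))) :
      Inv G D pr [(y, Q.sel r)] [r.1.2.1]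
  | chkT (y) (r : G.rules) (c) (h : D (pr sg (fun _ => [Sum.inl r.1.1])))
      (hc : Cond r.1 c (pr sg em)) : Inv G D pr [(y, Q.chk true r c)] [r.1.2.1]
  | chkF (r : G.rules) (c) (h : D (pr sg id))
      (hc : Cond r.1 c (pr em em)) : Inv G D pr [(Sum.inl r.1.1, Q.chk false r c)] []
  | exp (y w) (h : D (pr sg id)) : Inv G D pr [(y, Q.exp)] [w]
  | last1 (y z) (h : D (pr sg id)) : Inv G D pr [(y, Q.last z)] [[z]]
  | last0 (y z) (h : D (pr sg id)) : Inv G D pr [(y, Q.last z)] []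

lemma app_sing {α : Type} {l m : List α} {a b : α} :
    l ++ a :: m = [b] ↔ l = [] ∧ a = b ∧ m = [] := by
  cases l <;> simp

lemma pj_mark_irrel (G : RCG N T) (η μ μ') (p : List (Symb (NN G) T)) (h : marks G p = []) :
    prj G η μ p = prj G η μ' p := by
  induction p with
  | nil => rfl
  | cons a p ih =>
    rw [marks_cons, List.append_eq_nil_iff] at h
    rw [prj_cons, prj_cons, ih h.2]
    rcases a with (_ | _ | _) | _ <;> first | rfl | (simp [mk] at h)

lemma pj_head_irrel (G : RCG N T) (η η' μ) (p : List (Symb (NN G) T)) (h : heads G p = []) :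
    prj G η μ p = prj G η' μ p := by
  induction p with
  | nil => rfl
  | cons a p ih =>
    rw [heads_cons, List.append_eq_nil_iff] at h
    rw [prj_cons, prj_cons, ih h.2]
    rcases a with (_ | _ | _) | _ <;> first | rfl | (simp [hd] at h)

lemma mark_split (G : RCG N T) (s : List (Symb (NN G) T)) (w) (h : marks G s = [w]) :
    ∃ p q, s = p ++ Sum.inl (mark w) :: q ∧ marks G p = [] ∧ marks G q = [] := by
  induction s with
  | nil => simp at h
  | cons a s ih =>
    rcases a with (y | y | w') | y
    case inl.mark =>
      simp [mk] at h
      exact ⟨[], s, by simp [h.1], rfl, by simpa using h.2⟩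
    all_goals
      obtain ⟨p, q, rfl, h1, h2⟩ := ih (by simpa [mk] using h)
      exact ⟨_ :: p, q, rfl, by simpa [mk] using h1, h2⟩

lemma mem_heads (G : RCG N T) {y q} {s : List (Symb (NN G) T)} (h : Sum.inl (head y q) ∈ s) :
    (y, q) ∈ heads G s := List.mem_flatMap.2 ⟨_, h, by simp [hd]⟩

lemma mem_marks (G : RCG N T) {w} {s : List (Symb (NN G) T)} :
    w ∈ marks G s ↔ Sum.inl (mark w) ∈ s := by
  rw [marks, List.mem_flatMap]
  constructor
  · rintro ⟨a, h, ha⟩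
    rcases a with (_ | _ | _) | _ <;> simp [mk] at ha
    subst ha; exact h
  · intro h; exact ⟨_, h, by simp [mk]⟩

lemma mem_plain (G : RCG N T) (B : N) (η : Symb N T → List (Symb N T)) {p : List (Symb (NN G) T)}
    (h : heads G p = []) :
    Sum.inl B ∈ prj G η em p ↔ Sum.inl (plain (Sum.inl B)) ∈ p := by
  rw [prj, List.mem_flatMap]
  constructor
  · rintro ⟨a, ha, hm⟩
    rcases a with (y | ⟨y, q⟩ | _) | _ <;> simp [pj, em] at hm
    · subst hm; exact ha
    · have := mem_heads G ha
      simp [h] at this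
  · intro h; exact ⟨_, h, by simp [pj]⟩

lemma inv_step (G : RCG N T) (K : ℕ) (D : List (Symb N T) → Prop)
    (hD : ∀ s t, D s → G.Step false s t → D t) {s t : List (Symb (NN G) T)} (hst : St G K s t)
    (hi : Inv G D (fun η μ => prj G η μ s) (heads G s) (marks G s)) :
    Inv G D (fun η μ => prj G η μ t) (heads G t) (marks G t) := by
  obtain ⟨A, x, P, F, p, q, hr, rfl, rfl, hP, hF⟩ := hst
  generalize hH : heads G (p ++ Sum.inl A :: q) = H at hi
  generalize hM : marks G (p ++ Sum.inl A :: q) = M at hi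
  simp only [heads_append, heads_cons, marks_append, marks_cons] at hH hM
  have hPH : ∀ y q', Sum.inl (head y q') ∈ p ++ q → (y, q') ∈ H := by
    intro y q' h
    have := mem_heads G h
    rw [← hH]; simp at this ⊢; tauto
  have hPM : ∀ w, Sum.inl (mark w) ∈ p ++ q → w ∈ M := by
    intro w h
    have := (mem_marks G).2 h
    rw [← hM]; simp at this ⊢; tauto
  cases hr with
  | term a =>
    simp only [hd, mk, List.nil_append] at hH hM
    have e1 : heads G (p ++ [Sum.inr a] ++ q) = H := by simp [hd, ← hH]
    have e2 : marks G (p ++ [Sum.inr a] ++ q) = M := by simp [mk, ← hM]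
    rw [e1, e2]
    simpa [pj] using hi
  | hterm a =>
    cases hi <;> simp [hd, mk, app_sing] at hH hM
    rename_i h
    simp only [pj, prj_append, prj_cons, sg] at h
    simp [hd, mk, hH, hM]
    refine .fin ?_
    simpa [pj] using h
  | select y r =>
    cases hi <;> simp [hd, mk, app_sing] at hH hM
    rename_i y' h
    obtain ⟨hp, rfl, hq⟩ := hH
    simp [hd, mk, hp, hq, hM]
    refine .sel0 _ _ ?_
    simpa [pj] using h
  | self r =>
    cases hi <;> simp [hd, mk, app_sing] at hH hM
    rename_i y' h
    obtain ⟨hp, rfl, hq⟩ := hH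
    simp [hd, mk, hp, hq, hM]
    refine .chkF _ _ ?_ ?_
    · simpa [pj] using h
    · simp [Cond]
  | markit y r =>
    have h1 := hPH _ _ (hP _ rfl)
    have h2 := hF _ rfl
    rw [← mem_marks] at h2
    cases hi <;> simp [hd, mk] at hH hM h1
    case sel0 y' r' h =>
      obtain ⟨rfl, rfl⟩ := h1
      simp [hd, mk, hH]
      have e1 : marks G p = [] := by simpa using hM.1
      have e2 : marks G q = [] := by simpa using hM.2
      rw [e1, e2, List.nil_append]
      refine .sel1 _ _ ?_
      simp [pj] at h ⊢
      rw [pj_mark_irrel G sg _ id p e1, pj_mark_irrel G sg _ id q e2]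
      exact h
    case sel1 y' r' h =>
      obtain ⟨rfl, rfl⟩ := h1
      exfalso; apply h2
      rw [marks_append, hM]; simp
  | marked y r =>
    have h1 := hPM _ (hP _ rfl)
    cases hi <;> simp [hd, mk, app_sing] at hH hM h1
    rename_i y' r' h
    obtain ⟨hp, ⟨rfl, rfl⟩, hq⟩ := hH
    simp [hd, mk, hp, hq, hM]
    refine .chkT _ _ _ ?_ ?_
    · simpa [pj] using h
    · simp [Cond]
  | check y b r c B hb =>
    cases hi <;> simp [hd, mk, app_sing] at hH hM
    case chkT y' r' c' h hc =>
      obtain ⟨hp, ⟨rfl, rfl, rfl, rfl⟩, hq⟩ := hH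
      simp [hd, mk, hp, hq, hM]
      have hpq : heads G (p ++ q) = [] := by simp; exact ⟨by simpa using hp, by simpa using hq⟩
      have hmem := mem_plain G B sg hpq
      refine .chkT _ _ _ ?_ ?_
      · simpa [pj] using h
      · intro B' hB'
        rcases hB' with rfl | hB'
        · constructor
          · intro hB
            by_cases hy : y = Sum.inl B'
            · simp [pj, sg, hy]
            · have := hmem.2 (hP (plain (Sum.inl B')) ⟨rfl, hB, by simp [hy]⟩)
              rw [prj_append, List.mem_append] at this
              simp only [List.mem_append]
              tauto
          · intro hB hm
            have h3 := hF (plain (Sum.inl B')) ⟨rfl, hB⟩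
            rw [← hmem, prj_append, List.mem_append] at h3
            simp only [List.mem_append, pj, sg, List.mem_singleton] at hm
            have : ¬ (y = Sum.inl B') := fun e => hb ⟨rfl, e, hB⟩
            have this2 : ¬ (Sum.inl B' = y) := fun e => this e.symm
            tauto
        · simpa [pj] using hc B' hB'
    case chkF r' c' h hc =>
      obtain ⟨hp, ⟨rfl, rfl, rfl, rfl⟩, hq⟩ := hH
      simp [hd, mk, hp, hq, hM]
      have hpq : heads G (p ++ q) = [] := by simp; exact ⟨by simpa using hp, by simpa using hq⟩
      have hmem := mem_plain G B em hpq
      refine .chkF _ _ ?_ ?_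
      · simpa [pj] using h
      · intro B' hB'
        rcases hB' with rfl | hB'
        · constructor
          · intro hB
            have := hmem.2 (hP (plain (Sum.inl B')) ⟨rfl, hB, by simp⟩)
            rw [prj_append, List.mem_append] at this
            simp only [List.mem_append]
            tauto
          · intro hB hm
            have h3 := hF (plain (Sum.inl B')) ⟨rfl, hB⟩
            rw [← hmem, prj_append, List.mem_append] at h3
            simp only [List.mem_append, pj, em, List.not_mem_nil] at hm
            tauto
        · simpa [pj] using hc B' hB'
  | go y r =>
    cases hi <;> simp only [hd, mk, app_sing, List.cons_append, List.nil_append] at hH hM <;> simp at hH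
    rename_i y' r' c' h hc
    obtain ⟨hp, ⟨rfl, rfl, rfl⟩, hq⟩ := hH
    have e : marks G (p ++ [Sum.inl (head y Q.exp)] ++ q) = [r.1.2.1] := by
      simp [mk, hM]
    have e0 : ∀ η μ, prj G η μ (p ++ Sum.inl (head y (Q.chk true r Set.univ)) :: q) =
        prj G η μ (p ++ [Sum.inl (head y Q.exp)] ++ q) := by intro η μ; simp [pj]
    simp only [e0] at h hc
    have e1 : heads G (p ++ [Sum.inl (head y Q.exp)] ++ q) = [(y, Q.exp)] := by
      simp [hd]
      rw [app_sing]
      exact ⟨by simpa using hp, rfl, by simpa using hq⟩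
    rw [e1, e]
    refine .exp _ _ ?_
    obtain ⟨p', q', e2, hp', hq'⟩ := mark_split G _ _ e
    rw [e2] at h hc ⊢
    refine hD _ _ h ?_
    rw [step_iff]
    refine ⟨r.1.1, r.1.2.1, r.1.2.2.1, r.1.2.2.2, prj G sg em p', prj G sg em q',
      r.2, ?_, ?_, ?_, ?_⟩
    · rw [pj_mark_irrel G sg em (fun _ => [Sum.inl r.1.1]) p' hp', pj_mark_irrel G sg em (fun _ => [Sum.inl r.1.1]) q' hq']
      simp [pj]
    · rw [pj_mark_irrel G sg em id p' hp', pj_mark_irrel G sg em id q' hq']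
      simp [pj]
    · intro B hB
      simpa [pj, em] using (hc B (Set.mem_univ _)).1 hB
    · intro B hB
      simpa [pj, em] using (hc B (Set.mem_univ _)).2 hB
  | goself1 y z r hz =>
    cases hi <;> simp only [hd, mk, app_sing, List.cons_append, List.nil_append] at hH hM <;> simp at hH
    rename_i r' c' h hc
    obtain ⟨hp, ⟨rfl, rfl, rfl⟩, hq⟩ := hH
    have hp1 : heads G p = [] := by simpa using hp
    have hq1 : heads G q = [] := by simpa using hq
    rw [List.append_eq_nil_iff] at hM
    simp only [heads_append, heads_cons, heads_nil, marks_append, marks_cons, marks_nil, hp1, hq1, hM, hd, mk,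
      List.append_nil, List.nil_append]
    refine .idle _ ?_
    refine hD _ _ h ?_
    rw [step_iff]
    refine ⟨r.1.1, r.1.2.1, r.1.2.2.1, r.1.2.2.2, prj G em em p, prj G em em q,
      r.2, ?_, ?_, ?_, ?_⟩
    · rw [pj_mark_irrel G em em id p hM.1, pj_mark_irrel G em em id q hM.2,
        pj_head_irrel G em sg id p hp1, pj_head_irrel G em sg id q hq1]
      simp [pj, sg]
    · rw [pj_mark_irrel G em em id p hM.1, pj_mark_irrel G em em id q hM.2,
        pj_head_irrel G em sg id p hp1, pj_head_irrel G em sg id q hq1, hz]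
      simp [pj, sg]
    · intro B hB
      simpa [pj, em] using (hc B (Set.mem_univ _)).1 hB
    · intro B hB
      simpa [pj, em] using (hc B (Set.mem_univ _)).2 hB
  | goself2 y z z' w r hz =>
    cases hi <;> simp only [hd, mk, app_sing, List.cons_append, List.nil_append] at hH hM <;> simp at hH
    rename_i r' c' h hc
    obtain ⟨hp, ⟨rfl, rfl, rfl⟩, hq⟩ := hH
    have hp1 : heads G p = [] := by simpa using hp
    have hq1 : heads G q = [] := by simpa using hq
    rw [List.append_eq_nil_iff] at hM
    simp only [heads_append, heads_cons, heads_nil, marks_append, marks_cons, marks_nil, hp1, hq1, hM, hd, mk,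
      List.append_nil, List.nil_append]
    refine .exp _ _ ?_
    refine hD _ _ h ?_
    rw [step_iff]
    refine ⟨r.1.1, r.1.2.1, r.1.2.2.1, r.1.2.2.2, prj G em em p, prj G em em q,
      r.2, ?_, ?_, ?_, ?_⟩
    · rw [pj_mark_irrel G em em id p hM.1, pj_mark_irrel G em em id q hM.2,
        pj_head_irrel G em sg id p hp1, pj_head_irrel G em sg id q hq1]
      simp [pj, sg]
    · rw [pj_mark_irrel G em em id p hM.1, pj_mark_irrel G em em id q hM.2,
        pj_head_irrel G em sg id p hp1, pj_head_irrel G em sg id q hq1, hz]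
      simp [pj, sg]
    · intro B hB
      simpa [pj, em] using (hc B (Set.mem_univ _)).1 hB
    · intro B hB
      simpa [pj, em] using (hc B (Set.mem_univ _)).2 hB
  | expand y z z' w hw =>
    have h1 := hPH _ _ (hP _ rfl)
    cases hi <;> simp [hd, mk, app_sing] at hH hM h1
    rename_i y' w' h
    simp [hd, mk, hH, hM]
    refine .exp _ _ ?_
    simpa [pj] using h
  | tolast y z =>
    have h1 := hPM _ (hP _ rfl)
    cases hi <;> simp [hd, mk, app_sing] at hH hM h1
    rename_i y' w' h
    subst h1
    obtain ⟨hp, rfl, hq⟩ := hH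
    simp [hd, mk, hp, hq, hM]
    refine .last1 _ _ ?_
    simpa [pj] using h
  | lastx y z =>
    have h1 := hPH _ _ (hP _ rfl)
    cases hi <;> simp [hd, mk, app_sing] at hH hM h1
    rename_i y' w' h
    obtain ⟨rfl, rfl⟩ := h1
    simp [hd, mk, hH, hM]
    refine .last0 _ _ ?_
    simpa [pj] using h
  | toidle y z =>
    have h2 := hF _ rfl
    rw [← mem_marks, marks_append] at h2
    cases hi <;> simp only [hd, mk, app_sing, List.cons_append, List.nil_append] at hH hM <;> simp at hH
    case last1 y' z' h =>
      obtain ⟨hp, ⟨rfl, rfl⟩, hq⟩ := hH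
      rw [hM] at h2
      simp at h2
    case last0 y' z' h =>
      simp at hM
      obtain ⟨hp, ⟨rfl, rfl⟩, hq⟩ := hH
      simp [hd, mk, hp, hq, hM]
      refine .idle _ ?_
      simpa [pj] using h

lemma sound (G : RCG N T) (K : ℕ) (w : List T)
    (h : ReflTransGen (St G K) [Sum.inl (head (Sum.inl G.start) idle)] (w.map Sum.inr)) :
    ReflTransGen (G.Step false) [Sum.inl G.start] (w.map Sum.inr) := by
  let D := ReflTransGen (G.Step false) [Sum.inl G.start]
  have key : ∀ s, ReflTransGen (St G K) [Sum.inl (head (Sum.inl G.start) idle)] s →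
      Inv G D (fun η μ => prj G η μ s) (heads G s) (marks G s) := by
    intro s hs
    induction hs with
    | refl =>
      simp [hd, mk]
      refine .idle _ ?_
      simp [pj, sg]; exact .refl
    | tail _ hst ih =>
      exact inv_step G K D (fun s t h1 h2 => h1.tail h2) hst ih
  have hi := key _ h
  have e1 : heads G (w.map Sum.inr) = [] := by
    clear hi h
    induction w with
    | nil => rfl
    | cons a w ih => rw [List.map_cons, heads_cons, ih]; rfl
  have e2 : marks G (w.map Sum.inr) = [] := by
    clear hi h e1
    induction w with
    | nil => rfl
    | cons a w ih => rw [List.map_cons, marks_cons, ih]; rfl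
  rw [e1, e2] at hi
  cases hi with
  | fin h =>
    have e3 : ∀ w : List T, prj G sg id (w.map Sum.inr) = w.map Sum.inr := by
      intro w
      induction w with
      | nil => rfl
      | cons a w ih => rw [List.map_cons, prj_cons, ih]; rfl
    rw [e3] at h
    exact h

end Construction

lemma main_finite {N T : Type} [Finite N] [Finite T] (G : RCG N T) :
    ∃ (N' : Type) (G' : RCG N' T), G'.Lang false = G.Lang false ∧
      ∀ r ∈ G'.rules,
        ((∃ B C : N', r.2.1 = [Sum.inl B, Sum.inl C]) ∨
         (∃ B : N', r.2.1 = [Sum.inl B]) ∨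
         (∃ a : T, r.2.1 = [Sum.inr a] ∧ r.2.2.1 = ∅ ∧ r.2.2.2 = ∅)) ∧
        r.2.2.1.Subsingleton ∧ r.2.2.2.Subsingleton := by
  obtain ⟨K, hK⟩ : ∃ K, ∀ r ∈ G.rules, r.2.1.length ≤ K := by
    obtain ⟨K, hK⟩ := (G.fin.image (fun r => r.2.1.length)).bddAbove
    exact ⟨K, fun r hr => hK ⟨r, hr, rfl⟩⟩
  have hK' : ∀ r ∈ G.rules, r.2.1.length ≤ K + 1 := fun r hr => (hK r hr).trans (Nat.le_succ _)
  refine ⟨NN G, GG G (K + 1) hK' (by omega), ?_, ?_⟩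
  · ext w
    simp only [RCG.Lang, Set.mem_ofPred_eq, GG_step]
    exact ⟨sound G (K + 1) w, complete G (K + 1) hK' w⟩
  · intro r hr
    obtain ⟨h1, h2, h3, -⟩ := rl_spec G (K + 1) hK' (by omega) hr
    exact ⟨h1, h2, h3⟩

end RCLim

/-- every random context language is generated by a limited random
context grammar: productions of the forms A→BC, A→B (with arbitrary singleton-or-empty
context sets) or A→a (with empty context sets). -/
theorem rc_limited_normal_form (T : Type) (L : Set (List T)) (hL : L ∈ RC T) :
    ∃ (N : Type) (G : RCG N T), G.Lang false = L ∧
      ∀ r ∈ G.rules,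
        ((∃ B C : N, r.2.1 = [Sum.inl B, Sum.inl C]) ∨
         (∃ B : N, r.2.1 = [Sum.inl B]) ∨
         (∃ a : T, r.2.1 = [Sum.inr a] ∧ r.2.2.1 = ∅ ∧ r.2.2.2 = ∅)) ∧
        r.2.2.1.Subsingleton ∧ r.2.2.2.Subsingleton := by
  obtain ⟨N, G, rfl⟩ := hL
  obtain ⟨N₀, T₀, _, _, G₀, g, h0⟩ := RCLim.reduce G
  obtain ⟨N', G', h1, h2⟩ := RCLim.main_finite G₀
  obtain ⟨G'', h3, h4⟩ := RCLim.relabel G' g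
  refine ⟨N', G'', by rw [h3, h1, h0], ?_⟩
  intro r hr
  rw [h4] at hr
  obtain ⟨r', hr', rfl⟩ := hr
  obtain ⟨h5, h6, h7⟩ := h2 r' hr'
  refine ⟨?_, h6, h7⟩
  rcases h5 with ⟨B, C, h⟩ | ⟨B, h⟩ | ⟨a, h, hP, hF⟩
  · exact Or.inl ⟨B, C, by simp [h]⟩
  · exact Or.inr (Or.inl ⟨B, by simp [h]⟩)
  · exact Or.inr (Or.inr ⟨g a, by simp [h], hP, hF⟩)
end

section
/- The family of random context languages (generated by nonerasing random context grammars) is properly contained in the family of context-sensitive languages. -/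
/-- A context-sensitive (length-nondecreasing) grammar: finitely many productions
`l → r` with `|l| ≤ |r|` and `l` containing at least one nonterminal. -/
structure CSG (N T : Type) where
  rules : Set (List (Symb N T) × List (Symb N T))
  fin : rules.Finite
  lhs_nt : ∀ r ∈ rules, ∃ A : N, Sum.inl A ∈ r.1
  len : ∀ r ∈ rules, r.1.length ≤ r.2.length
  start : N

def CSG.Step {N T : Type} (G : CSG N T) (s₁ s₂ : List (Symb N T)) : Prop :=
  ∃ l r u v, (l, r) ∈ G.rules ∧ s₁ = u ++ l ++ v ∧ s₂ = u ++ r ++ v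

def CSG.Lang {N T : Type} (G : CSG N T) : Set (List T) :=
  {w | Relation.ReflTransGen G.Step [Sum.inl G.start] (w.map Sum.inr)}

/-- The family of context-sensitive languages over `T`. -/
def CS (T : Type) : Set (Set (List T)) :=
  {L | ∃ (N : Type) (G : CSG N T), G.Lang = L}


namespace RCP

/-! ### Iterated nonerasing finite state transductions -/

/-- A nonerasing nondeterministic finite state transducer. -/
structure FST (Γ Q : Type) where
  δ : Set (Q × Γ × List Γ × Q)
  fin : δ.Finite
  ne : ∀ t ∈ δ, t.2.2.1 ≠ []
  I : Set Q
  Ifin : I.Finite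
  F : Set Q

inductive FST.Run {Γ Q : Type} (A : FST Γ Q) : Q → List Γ → List Γ → Q → Prop
  | nil (q : Q) : A.Run q [] [] q
  | cons {q q' q'' : Q} {x : Γ} {y W W' : List Γ} : (q, x, y, q') ∈ A.δ → A.Run q' W W' q'' →
      A.Run q (x :: W) (y ++ W') q''

def FST.Sweep {Γ Q : Type} (A : FST Γ Q) (W W' : List Γ) : Prop :=
  ∃ q₀ ∈ A.I, ∃ q ∈ A.F, A.Run q₀ W W' q

theorem FST.Run.append {Γ Q : Type} {A : FST Γ Q} {q q' q'' : Q} {W U W' U' : List Γ}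
    (h : A.Run q W U q') (h' : A.Run q' W' U' q'') : A.Run q (W ++ W') (U ++ U') q'' := by
  induction h with
  | nil => simpa using h'
  | cons hd _ ih =>
    rw [List.cons_append, List.append_assoc]
    exact .cons hd (ih h')

theorem FST.Run.snoc {Γ Q : Type} {A : FST Γ Q} {q q' q'' : Q} {W U y : List Γ} {x : Γ}
    (h : A.Run q W U q') (h' : (q', x, y, q'') ∈ A.δ) : A.Run q (W ++ [x]) (U ++ y) q'' := by
  have := h.append (.cons h' (.nil q''))
  simpa using this

inductive Hd (Q : Type)
  | none | fwd (q : Q) | back | fin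

abbrev Cell (Γ Q : Type) := Γ × Bool × Bool × Hd Q

section
variable {M T Q : Type}

/-- Symbols of the simulating grammar. -/
abbrev CSym (M T Q : Type) := Symb (Cell (Symb M T) Q) T

def cc (x : Symb M T) (l r : Bool) (h : Hd Q) : CSym M T Q := Sum.inl (x, l, r, h)

def outc (l : Bool) : List (Symb M T) → List (CSym M T Q)
  | [] => []
  | x :: xs => cc x l false .none :: outc false xs

def rc : List (Symb M T) → List (CSym M T Q)
  | [] => []
  | x :: xs => cc x false xs.isEmpty .none :: rc xs

theorem outc_append (l : Bool) (W y : List (Symb M T)) :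
    (outc l (W ++ y) : List (CSym M T Q)) = outc l W ++ outc (l && W.isEmpty) y := by
  induction W generalizing l with
  | nil => simp [outc]
  | cons x W ih => simp [outc, ih]

theorem outc_snoc (l : Bool) (W : List (Symb M T)) (x : Symb M T) :
    (outc l (W ++ [x]) : List (CSym M T Q)) = outc l W ++ [cc x (l && W.isEmpty) false .none] := by
  rw [outc_append]; rfl

theorem outc_length (l : Bool) (W : List (Symb M T)) :
    (outc l W : List (CSym M T Q)).length = W.length := by
  induction W generalizing l with
  | nil => rfl
  | cons x W ih => simp [outc, ih]

/-- The rules of the simulating grammar. -/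
inductive Rl (A : FST (Symb M T) Q) (V : Set (Symb M T)) :
    List (CSym M T Q) → List (CSym M T Q) → Prop
  | start (x r q) : x ∈ V → q ∈ A.I → Rl A V [cc x true r .back] [cc x true r (.fwd q)]
  | startfin (x r) : x ∈ V → Rl A V [cc x true r .back] [cc x true r .fin]
  | mv (l q x y q' x' r) : (q, x, y, q') ∈ A.δ → x' ∈ V →
      Rl A V [cc x l false (.fwd q), cc x' false r .none] (outc l y ++ [cc x' false r (.fwd q')])
  | fend (l q x y z q') : (q, x, y ++ [z], q') ∈ A.δ → q' ∈ A.F →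
      Rl A V [cc x l true (.fwd q)] (outc l y ++ [cc z (l && y.isEmpty) true .back])
  | bk (x' l x r) : x' ∈ V → x ∈ V →
      Rl A V [cc x' l false .none, cc x false r .back] [cc x' l false .back, cc x false r .none]
  | fn (t l x' r) : Sum.inr t ∈ V → x' ∈ V →
      Rl A V [cc (Sum.inr t) l false .fin, cc x' false r .none] [Sum.inr t, cc x' false r .fin]
  | fnend (t l) : Sum.inr t ∈ V → Rl A V [cc (Sum.inr t) l true .fin] [Sum.inr t]

theorem Rl_finite (A : FST (Symb M T) Q) (V : Set (Symb M T)) (hV : V.Finite) :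
    {p : List (CSym M T Q) × List (CSym M T Q) | Rl A V p.1 p.2}.Finite := by
  have hB : (Set.univ : Set Bool).Finite := Set.finite_univ
  have hVt : {t : T | Sum.inr t ∈ V}.Finite := hV.preimage (Sum.inr_injective.injOn)
  let S1 := (fun p : Symb M T × Bool × Q =>
    (([cc p.1 true p.2.1 .back], [cc p.1 true p.2.1 (.fwd p.2.2)]) :
      List (CSym M T Q) × List (CSym M T Q))) '' (V ×ˢ Set.univ ×ˢ A.I)
  let S2 := (fun p : Symb M T × Bool =>
    (([cc p.1 true p.2 .back], [cc p.1 true p.2 .fin]) :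
      List (CSym M T Q) × List (CSym M T Q))) '' (V ×ˢ Set.univ)
  let S3 := (fun p : Bool × (Q × Symb M T × List (Symb M T) × Q) × Symb M T × Bool =>
    (([cc p.2.1.2.1 p.1 false (.fwd p.2.1.1), cc p.2.2.1 false p.2.2.2 .none],
      outc p.1 p.2.1.2.2.1 ++ [cc p.2.2.1 false p.2.2.2 (.fwd p.2.1.2.2.2)]) :
      List (CSym M T Q) × List (CSym M T Q))) '' (Set.univ ×ˢ A.δ ×ˢ V ×ˢ Set.univ)
  let S4 := (fun p : Bool × (Q × Symb M T × List (Symb M T) × Q) =>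
    (([cc p.2.2.1 p.1 true (.fwd p.2.1)],
      outc p.1 p.2.2.2.1.dropLast ++ (p.2.2.2.1.getLast?.toList.map fun z =>
        cc z (p.1 && p.2.2.2.1.dropLast.isEmpty) true .back)) :
      List (CSym M T Q) × List (CSym M T Q))) '' (Set.univ ×ˢ A.δ)
  let S5 := (fun p : Symb M T × Bool × Symb M T × Bool =>
    (([cc p.1 p.2.1 false .none, cc p.2.2.1 false p.2.2.2 .back],
      [cc p.1 p.2.1 false .back, cc p.2.2.1 false p.2.2.2 .none]) :
      List (CSym M T Q) × List (CSym M T Q))) '' (V ×ˢ Set.univ ×ˢ V ×ˢ Set.univ)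
  let S6 := (fun p : T × Bool × Symb M T × Bool =>
    (([cc (Sum.inr p.1) p.2.1 false .fin, cc p.2.2.1 false p.2.2.2 .none],
      [Sum.inr p.1, cc p.2.2.1 false p.2.2.2 .fin]) :
      List (CSym M T Q) × List (CSym M T Q))) ''
        ({t : T | Sum.inr t ∈ V} ×ˢ Set.univ ×ˢ V ×ˢ Set.univ)
  let S7 := (fun p : T × Bool =>
    (([cc (Sum.inr p.1) p.2 true .fin], [Sum.inr p.1]) :
      List (CSym M T Q) × List (CSym M T Q))) '' ({t : T | Sum.inr t ∈ V} ×ˢ Set.univ)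
  have hfin : (S1 ∪ S2 ∪ S3 ∪ S4 ∪ S5 ∪ S6 ∪ S7).Finite := by
    refine Set.Finite.union (Set.Finite.union (Set.Finite.union (Set.Finite.union
      (Set.Finite.union (Set.Finite.union ?_ ?_) ?_) ?_) ?_) ?_) ?_
    · exact (hV.prod (hB.prod A.Ifin)).image _
    · exact (hV.prod hB).image _
    · exact (hB.prod (A.fin.prod (hV.prod hB))).image _
    · exact (hB.prod A.fin).image _
    · exact (hV.prod (hB.prod (hV.prod hB))).image _
    · exact (hVt.prod (hB.prod (hV.prod hB))).image _
    · exact (hVt.prod hB).image _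
  refine hfin.subset ?_
  rintro ⟨a, b⟩ h
  simp only [Set.mem_ofPred_eq] at h
  cases h with
  | start x r q hx hq =>
    exact .inl <| .inl <| .inl <| .inl <| .inl <| .inl ⟨(x, r, q), ⟨hx, trivial, hq⟩, rfl⟩
  | startfin x r hx =>
    exact .inl <| .inl <| .inl <| .inl <| .inl <| .inr ⟨(x, r), ⟨hx, trivial⟩, rfl⟩
  | mv l q x y q' x' r h hx =>
    exact .inl <| .inl <| .inl <| .inl <| .inr
      ⟨(l, (q, x, y, q'), x', r), ⟨trivial, h, hx, trivial⟩, rfl⟩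
  | fend l q x y z q' h hq =>
    exact .inl <| .inl <| .inl <| .inr
      ⟨(l, (q, x, y ++ [z], q')), ⟨trivial, h⟩, by simp⟩
  | bk x' l x r hx' hx =>
    exact .inl <| .inl <| .inr ⟨(x', l, x, r), ⟨hx', trivial, hx, trivial⟩, rfl⟩
  | fn t l x' r ht hx =>
    exact .inl <| .inr ⟨(t, l, x', r), ⟨ht, trivial, hx, trivial⟩, rfl⟩
  | fnend t l ht => exact .inr ⟨(t, l), ⟨ht, trivial⟩, rfl⟩

def simG (A : FST (Symb M T) Q) (V : Set (Symb M T)) (hV : V.Finite) (s : M) :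
    CSG (Cell (Symb M T) Q) T where
  rules := {p | Rl A V p.1 p.2}
  fin := Rl_finite A V hV
  lhs_nt := by
    rintro ⟨a, b⟩ h
    simp only [Set.mem_ofPred_eq] at h
    cases h <;> exact ⟨_, List.mem_cons_self ..⟩
  len := by
    rintro ⟨a, b⟩ h
    simp only [Set.mem_ofPred_eq] at h
    cases h with
    | mv l q x y q' x' r h hx =>
      have := List.length_pos_iff.2 (A.ne _ h)
      simp only [List.length_append, outc_length, List.length_cons, List.length_nil] at *
      omega
    | fend => simp
    | _ => simp
  start := (Sum.inl s, true, true, .back)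

/-- head symbols -/
def isHd : CSym M T Q → Prop
  | Sum.inl (_, _, _, .none) => False
  | Sum.inl _ => True
  | Sum.inr _ => False

theorem not_isHd_outc {l : Bool} {W : List (Symb M T)} :
    ∀ a ∈ (outc l W : List (CSym M T Q)), ¬ isHd a := by
  induction W generalizing l with
  | nil => simp [outc]
  | cons x W ih =>
    intro a ha
    simp only [outc, List.mem_cons] at ha
    rcases ha with rfl | ha
    · simp [cc, isHd]
    · exact ih a ha

theorem not_isHd_rc {W : List (Symb M T)} :
    ∀ a ∈ (rc W : List (CSym M T Q)), ¬ isHd a := by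
  induction W with
  | nil => simp [rc]
  | cons x W ih =>
    intro a ha
    simp only [rc, List.mem_cons] at ha
    rcases ha with rfl | ha
    · simp [cc, isHd]
    · exact ih a ha

theorem not_isHd_map {W : List T} :
    ∀ a ∈ (W.map Sum.inr : List (CSym M T Q)), ¬ isHd a := by
  intro a ha
  simp only [List.mem_map] at ha
  obtain ⟨t, _, rfl⟩ := ha
  simp [isHd]

theorem hd_unique {α : Type} (p : α → Prop) {A B A' B' : List α} {h h' : α}
    (hA : ∀ a ∈ A, ¬ p a) (hB : ∀ a ∈ B, ¬ p a) (hp : p h')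
    (e : A ++ h :: B = A' ++ h' :: B') : A = A' ∧ h = h' ∧ B = B' := by
  induction A generalizing A' with
  | nil =>
    cases A' with
    | nil => simpa using e
    | cons a A' =>
      simp only [List.nil_append, List.cons_append, List.cons.injEq] at e
      exact absurd hp (hB _ (by simp [e.2]))
  | cons a A ih =>
    cases A' with
    | nil =>
      simp only [List.nil_append, List.cons_append, List.cons.injEq] at e
      exact absurd hp (e.1 ▸ hA a (by simp))
    | cons a' A' =>
      simp only [List.cons_append, List.cons.injEq] at e
      have := ih (fun b hb => hA b (by simp [hb])) e.2
      exact ⟨by rw [e.1, this.1], this.2⟩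

theorem outc_eq_snoc {l : Bool} {W : List (Symb M T)} {u : List (CSym M T Q)} {c : CSym M T Q}
    (h : outc l W = u ++ [c]) : ∃ W' x, W = W' ++ [x] ∧ u = outc l W' ∧
      c = cc x (l && W'.isEmpty) false .none := by
  rcases List.eq_nil_or_concat W with rfl | ⟨W', x, rfl⟩
  · simp [outc] at h
  · rw [List.concat_eq_append, outc_snoc] at h
    have := List.append_inj' h rfl
    exact ⟨W', x, by simp, this.1.symm, by simpa using this.2.symm⟩

theorem rc_eq_cons {W : List (Symb M T)} {u : List (CSym M T Q)} {c : CSym M T Q}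
    (h : rc W = c :: u) : ∃ x W', W = x :: W' ∧ u = rc W' ∧
      c = cc x false W'.isEmpty .none := by
  cases W with
  | nil => simp [rc] at h
  | cons x W =>
    simp only [rc, List.cons.injEq] at h
    exact ⟨x, W, rfl, h.2.symm, h.1.symm⟩

def Reach (A : FST (Symb M T) Q) (s : M) (W : List (Symb M T)) : Prop :=
  Relation.ReflTransGen A.Sweep [Sum.inl s] W

def Inv (A : FST (Symb M T) Q) (s : M) (f : List (CSym M T Q)) : Prop :=
  (∃ W1 x W2, Reach A s (W1 ++ x :: W2) ∧
    f = outc true W1 ++ cc x W1.isEmpty W2.isEmpty .back :: rc W2) ∨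
  (∃ U W1 x W2 q0 q, q0 ∈ A.I ∧ Reach A s (W1 ++ x :: W2) ∧ A.Run q0 W1 U q ∧
    f = outc true U ++ cc x U.isEmpty W2.isEmpty (.fwd q) :: rc W2) ∨
  (∃ (ts : List T) (x : Symb M T) (l : Bool) (W2 : List (Symb M T)),
    Reach A s (ts.map Sum.inr ++ x :: W2) ∧
    f = ts.map Sum.inr ++ cc x l W2.isEmpty .fin :: rc W2) ∨
  (∃ ts : List T, Reach A s (ts.map Sum.inr) ∧ f = ts.map Sum.inr)

theorem cc_inj {x x' : Symb M T} {l l' r r' : Bool} {h h' : Hd Q} :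
    cc x l r h = cc x' l' r' h' ↔ x = x' ∧ l = l' ∧ r = r' ∧ h = h' := by
  simp [cc]

theorem inv_step {A : FST (Symb M T) Q} {V : Set (Symb M T)} {hV : V.Finite} {s : M}
    {f f' : List (CSym M T Q)} (hI : Inv A s f) (hs : (simG A V hV s).Step f f') :
    Inv A s f' := by
  obtain ⟨l, r, u, v, hR, e1, rfl⟩ := hs
  change Rl A V l r at hR
  rcases hI with ⟨W1, x, W2, hr, e⟩ | ⟨U, W1, x, W2, q0, q, hq0, hr, hrun, e⟩ |
      ⟨ts, x, l', W2, hr, e⟩ | ⟨ts, hr, e⟩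
  · -- back configuration
    cases hR with
    | start x' r q hx hq =>
      rw [e] at e1
      have e1' : outc true W1 ++ cc x W1.isEmpty W2.isEmpty .back :: rc W2 =
        u ++ cc x' true r .back :: v := by rw [e1]; simp
      obtain ⟨rfl, h2, rfl⟩ := hd_unique isHd not_isHd_outc not_isHd_rc (by simp [cc, isHd]) e1'
      rw [cc_inj] at h2
      obtain ⟨rfl, h2, rfl, -⟩ := h2
      have : W1 = [] := by simpa using h2
      subst this
      exact .inr <| .inl ⟨[], [], x, W2, q, q, hq, hr, .nil q, by simp [outc]⟩
    | startfin x' r hx =>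
      rw [e] at e1
      have e1' : outc true W1 ++ cc x W1.isEmpty W2.isEmpty .back :: rc W2 =
        u ++ cc x' true r .back :: v := by rw [e1]; simp
      obtain ⟨rfl, h2, rfl⟩ := hd_unique isHd not_isHd_outc not_isHd_rc (by simp [cc, isHd]) e1'
      rw [cc_inj] at h2
      obtain ⟨rfl, h2, rfl, -⟩ := h2
      have : W1 = [] := by simpa using h2
      subst this
      exact .inr <| .inr <| .inl ⟨[], x, true, W2, hr, by simp [outc]⟩
    | mv l q x' y q' x'' r hd hx =>
      rw [e] at e1
      have e1' : outc true W1 ++ cc x W1.isEmpty W2.isEmpty .back :: rc W2 =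
        u ++ cc x' l false (.fwd q) :: (cc x'' false r .none :: v) := by rw [e1]; simp
      obtain ⟨_, h2, _⟩ := hd_unique isHd not_isHd_outc not_isHd_rc (by simp [cc, isHd]) e1'
      simp [cc_inj] at h2
    | fend l q x' y z q' hd hq =>
      rw [e] at e1
      have e1' : outc true W1 ++ cc x W1.isEmpty W2.isEmpty .back :: rc W2 =
        u ++ cc x' l true (.fwd q) :: v := by rw [e1]; simp
      obtain ⟨_, h2, _⟩ := hd_unique isHd not_isHd_outc not_isHd_rc (by simp [cc, isHd]) e1'
      simp [cc_inj] at h2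
    | bk x' l x'' r hx' hx =>
      rw [e] at e1
      have e1' : outc true W1 ++ cc x W1.isEmpty W2.isEmpty .back :: rc W2 =
        (u ++ [cc x' l false .none]) ++ cc x'' false r .back :: v := by rw [e1]; simp
      obtain ⟨h1, h2, rfl⟩ := hd_unique isHd not_isHd_outc not_isHd_rc (by simp [cc, isHd]) e1'
      rw [cc_inj] at h2
      obtain ⟨rfl, h2, rfl, -⟩ := h2
      obtain ⟨W', z, rfl, rfl, h3⟩ := outc_eq_snoc h1
      rw [cc_inj] at h3
      obtain ⟨rfl, rfl, -⟩ := h3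
      exact .inl ⟨W', x', x :: W2, by simpa using hr, by simp [rc]⟩
    | fn t l x' r ht hx =>
      rw [e] at e1
      have e1' : outc true W1 ++ cc x W1.isEmpty W2.isEmpty .back :: rc W2 =
        u ++ cc (Sum.inr t) l false .fin :: (cc x' false r .none :: v) := by rw [e1]; simp
      obtain ⟨_, h2, _⟩ := hd_unique isHd not_isHd_outc not_isHd_rc (by simp [cc, isHd]) e1'
      simp [cc_inj] at h2
    | fnend t l ht =>
      rw [e] at e1
      have e1' : outc true W1 ++ cc x W1.isEmpty W2.isEmpty .back :: rc W2 =
        u ++ cc (Sum.inr t) l true .fin :: v := by rw [e1]; simp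
      obtain ⟨_, h2, _⟩ := hd_unique isHd not_isHd_outc not_isHd_rc (by simp [cc, isHd]) e1'
      simp [cc_inj] at h2
  · cases hR with
    | start x' r q1 hx hq =>
      rw [e] at e1
      have e1' : outc true U ++ cc x U.isEmpty W2.isEmpty (.fwd q) :: rc W2 =
        u ++ cc x' true r .back :: v := by rw [e1]; simp
      obtain ⟨_, h2, _⟩ := hd_unique isHd not_isHd_outc not_isHd_rc (by simp [cc, isHd]) e1'
      simp [cc_inj] at h2
    | startfin x' r hx =>
      rw [e] at e1
      have e1' : outc true U ++ cc x U.isEmpty W2.isEmpty (.fwd q) :: rc W2 =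
        u ++ cc x' true r .back :: v := by rw [e1]; simp
      obtain ⟨_, h2, _⟩ := hd_unique isHd not_isHd_outc not_isHd_rc (by simp [cc, isHd]) e1'
      simp [cc_inj] at h2
    | mv l q1 x' y q' x'' r hd hx =>
      rw [e] at e1
      have e1' : outc true U ++ cc x U.isEmpty W2.isEmpty (.fwd q) :: rc W2 =
        u ++ cc x' l false (.fwd q1) :: (cc x'' false r .none :: v) := by rw [e1]; simp
      obtain ⟨rfl, h2, h3⟩ := hd_unique isHd not_isHd_outc not_isHd_rc (by simp [cc, isHd]) e1'
      rw [cc_inj] at h2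
      obtain ⟨rfl, rfl, h2, h4⟩ := h2
      obtain ⟨rfl⟩ := h4
      obtain ⟨z, W', rfl, rfl, h5⟩ := rc_eq_cons h3
      rw [cc_inj] at h5
      obtain ⟨rfl, -, rfl, -⟩ := h5
      have hy := A.ne _ hd
      refine .inr <| .inl ⟨U ++ y, W1 ++ [x], x'', W', q0, q', hq0, by simpa using hr,
        hrun.snoc hd, ?_⟩
      have : (U ++ y).isEmpty = false := by
        cases U <;> cases y <;> simp_all
      simp [outc_append, this]
    | fend l q1 x' y z q' hd hq =>
      rw [e] at e1
      have e1' : outc true U ++ cc x U.isEmpty W2.isEmpty (.fwd q) :: rc W2 =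
        u ++ cc x' l true (.fwd q1) :: v := by rw [e1]; simp
      obtain ⟨rfl, h2, rfl⟩ := hd_unique isHd not_isHd_outc not_isHd_rc (by simp [cc, isHd]) e1'
      rw [cc_inj] at h2
      obtain ⟨rfl, rfl, h2, h4⟩ := h2
      obtain ⟨rfl⟩ := h4
      have : W2 = [] := by simpa using h2
      subst this
      refine .inl ⟨U ++ y, z, [], ?_, ?_⟩
      · refine Relation.ReflTransGen.tail hr ⟨q0, hq0, q', hq, ?_⟩
        simpa using hrun.snoc hd
      · simp only [outc_append, rc]
        cases U <;> simp
    | bk x' l x'' r hx' hx =>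
      rw [e] at e1
      have e1' : outc true U ++ cc x U.isEmpty W2.isEmpty (.fwd q) :: rc W2 =
        (u ++ [cc x' l false .none]) ++ cc x'' false r .back :: v := by rw [e1]; simp
      obtain ⟨_, h2, _⟩ := hd_unique isHd not_isHd_outc not_isHd_rc (by simp [cc, isHd]) e1'
      simp [cc_inj] at h2
    | fn t l x' r ht hx =>
      rw [e] at e1
      have e1' : outc true U ++ cc x U.isEmpty W2.isEmpty (.fwd q) :: rc W2 =
        u ++ cc (Sum.inr t) l false .fin :: (cc x' false r .none :: v) := by rw [e1]; simp
      obtain ⟨_, h2, _⟩ := hd_unique isHd not_isHd_outc not_isHd_rc (by simp [cc, isHd]) e1'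
      simp [cc_inj] at h2
    | fnend t l ht =>
      rw [e] at e1
      have e1' : outc true U ++ cc x U.isEmpty W2.isEmpty (.fwd q) :: rc W2 =
        u ++ cc (Sum.inr t) l true .fin :: v := by rw [e1]; simp
      obtain ⟨_, h2, _⟩ := hd_unique isHd not_isHd_outc not_isHd_rc (by simp [cc, isHd]) e1'
      simp [cc_inj] at h2
  · cases hR with
    | start x' r q1 hx hq =>
      rw [e] at e1
      have e1' : ts.map Sum.inr ++ cc x l' W2.isEmpty .fin :: rc W2 =
        u ++ cc x' true r .back :: v := by rw [e1]; simp
      obtain ⟨_, h2, _⟩ := hd_unique isHd not_isHd_map not_isHd_rc (by simp [cc, isHd]) e1'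
      simp [cc_inj] at h2
    | startfin x' r hx =>
      rw [e] at e1
      have e1' : ts.map Sum.inr ++ cc x l' W2.isEmpty .fin :: rc W2 =
        u ++ cc x' true r .back :: v := by rw [e1]; simp
      obtain ⟨_, h2, _⟩ := hd_unique isHd not_isHd_map not_isHd_rc (by simp [cc, isHd]) e1'
      simp [cc_inj] at h2
    | mv l q1 x' y q' x'' r hd hx =>
      rw [e] at e1
      have e1' : ts.map Sum.inr ++ cc x l' W2.isEmpty .fin :: rc W2 =
        u ++ cc x' l false (.fwd q1) :: (cc x'' false r .none :: v) := by rw [e1]; simp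
      obtain ⟨_, h2, _⟩ := hd_unique isHd not_isHd_map not_isHd_rc (by simp [cc, isHd]) e1'
      simp [cc_inj] at h2
    | fend l q1 x' y z q' hd hq =>
      rw [e] at e1
      have e1' : ts.map Sum.inr ++ cc x l' W2.isEmpty .fin :: rc W2 =
        u ++ cc x' l true (.fwd q1) :: v := by rw [e1]; simp
      obtain ⟨_, h2, _⟩ := hd_unique isHd not_isHd_map not_isHd_rc (by simp [cc, isHd]) e1'
      simp [cc_inj] at h2
    | bk x' l x'' r hx' hx =>
      rw [e] at e1
      have e1' : ts.map Sum.inr ++ cc x l' W2.isEmpty .fin :: rc W2 =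
        (u ++ [cc x' l false .none]) ++ cc x'' false r .back :: v := by rw [e1]; simp
      obtain ⟨_, h2, _⟩ := hd_unique isHd not_isHd_map not_isHd_rc (by simp [cc, isHd]) e1'
      simp [cc_inj] at h2
    | fn t l x' r ht hx =>
      rw [e] at e1
      have e1' : ts.map Sum.inr ++ cc x l' W2.isEmpty .fin :: rc W2 =
        u ++ cc (Sum.inr t) l false .fin :: (cc x' false r .none :: v) := by rw [e1]; simp
      obtain ⟨rfl, h2, h3⟩ := hd_unique isHd not_isHd_map not_isHd_rc (by simp [cc, isHd]) e1'
      rw [cc_inj] at h2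
      obtain ⟨rfl, rfl, h2, -⟩ := h2
      obtain ⟨z, W', rfl, rfl, h5⟩ := rc_eq_cons h3
      rw [cc_inj] at h5
      obtain ⟨rfl, -, rfl, -⟩ := h5
      exact .inr <| .inr <| .inl ⟨ts ++ [t], x', false, W', by simpa using hr, by simp⟩
    | fnend t l ht =>
      rw [e] at e1
      have e1' : ts.map Sum.inr ++ cc x l' W2.isEmpty .fin :: rc W2 =
        u ++ cc (Sum.inr t) l true .fin :: v := by rw [e1]; simp
      obtain ⟨rfl, h2, rfl⟩ := hd_unique isHd not_isHd_map not_isHd_rc (by simp [cc, isHd]) e1'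
      rw [cc_inj] at h2
      obtain ⟨rfl, rfl, h2, -⟩ := h2
      have : W2 = [] := by simpa using h2
      subst this
      exact .inr <| .inr <| .inr ⟨ts ++ [t], by simpa using hr, by simp [rc]⟩
  · exfalso
    obtain ⟨c, hc⟩ := (simG A V hV s).lhs_nt (l, r) hR
    have : (Sum.inl c : CSym M T Q) ∈ f := by rw [e1]; simp [hc]
    rw [e] at this
    simp at this

theorem sim_sound {A : FST (Symb M T) Q} {V : Set (Symb M T)} {hV : V.Finite} {s : M}
    {w : List T} (h : w ∈ (simG A V hV s).Lang) : Reach A s (w.map Sum.inr) := by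
  have key : Inv A s (w.map Sum.inr) := by
    have h' : Relation.ReflTransGen (simG A V hV s).Step
      [Sum.inl (simG A V hV s).start] (w.map Sum.inr) := h
    generalize (w.map Sum.inr : List (CSym M T Q)) = f at h'
    induction h' with
    | refl => exact .inl ⟨[], Sum.inl s, [], .refl, rfl⟩
    | tail _ h ih => exact inv_step ih h
  have hcontra : ∀ (a b : List (CSym M T Q)) x l r h,
      w.map Sum.inr = a ++ cc x l r h :: b → False := by
    intro a b x l r h e
    have : (cc x l r h : CSym M T Q) ∈ (w.map Sum.inr : List (CSym M T Q)) := by rw [e]; simp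
    simp [cc] at this
  rcases key with ⟨W1, x, W2, hr, e⟩ | ⟨U, W1, x, W2, q0, q, hq0, hr, hrun, e⟩ |
      ⟨ts, x, l', W2, hr, e⟩ | ⟨ts, hr, e⟩
  · exact (hcontra _ _ _ _ _ _ e).elim
  · exact (hcontra _ _ _ _ _ _ e).elim
  · exact (hcontra _ _ _ _ _ _ e).elim
  · have : w = ts := List.map_injective_iff.2 Sum.inr_injective e
    rw [this]; exact hr

theorem csg_step {A : FST (Symb M T) Q} {V : Set (Symb M T)} {hV : V.Finite} {s0 : M}
    {l r : List (CSym M T Q)} (h : Rl A V l r)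
    (u v : List (CSym M T Q)) {s s' : List (CSym M T Q)} (e : s = u ++ l ++ v)
    (e' : s' = u ++ r ++ v) : Relation.ReflTransGen (simG A V hV s0).Step s s' :=
  .single ⟨l, r, u, v, h, e, e'⟩

theorem run_out {A : FST (Symb M T) Q} {V : Set (Symb M T)}
    (hδ : ∀ t ∈ A.δ, ∀ z ∈ t.2.2.1, z ∈ V) {q q' : Q} {W W' : List (Symb M T)}
    (h : A.Run q W W' q') : ∀ z ∈ W', z ∈ V := by
  induction h with
  | nil => simp
  | cons hd _ ih =>
    intro z hz
    rcases List.mem_append.1 hz with hz | hz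
    · exact hδ _ hd z hz
    · exact ih z hz

theorem reach_V {A : FST (Symb M T) Q} {V : Set (Symb M T)} {s : M} (hs : Sum.inl s ∈ V)
    (hδ : ∀ t ∈ A.δ, ∀ z ∈ t.2.2.1, z ∈ V) {W : List (Symb M T)} (h : Reach A s W) :
    ∀ z ∈ W, z ∈ V := by
  induction h with
  | refl => simpa using hs
  | tail _ h ih =>
    obtain ⟨_, _, _, _, hr⟩ := h
    exact run_out hδ hr

theorem sim_fwd {A : FST (Symb M T) Q} {V : Set (Symb M T)} {hV : V.Finite} {s : M}
    (W2 : List (Symb M T)) (x : Symb M T) (U U' : List (Symb M T)) (q q' : Q)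
    (hW : ∀ z ∈ W2, z ∈ V) (hq' : q' ∈ A.F) (h : A.Run q (x :: W2) U' q') :
    ∃ W' z, U ++ U' = W' ++ [z] ∧ Relation.ReflTransGen (simG A V hV s).Step
      (outc true U ++ cc x U.isEmpty W2.isEmpty (.fwd q) :: rc W2)
      (outc true W' ++ [cc z W'.isEmpty true .back]) := by
  induction W2 generalizing x U U' q with
  | nil =>
    cases h with
    | @cons _ q1 _ _ y W W'' hd hr =>
      cases hr
      rcases List.eq_nil_or_concat y with rfl | ⟨y, z, rfl⟩
      · exact absurd rfl (A.ne _ hd)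
      · rw [List.concat_eq_append] at hd
        refine ⟨U ++ y, z, by simp, csg_step (Rl.fend U.isEmpty q x y z _ hd hq')
          (outc true U) [] (by simp [rc]) ?_⟩
        rw [outc_append]
        cases U <;> simp
  | cons x' W2 ih =>
    cases h with
    | @cons _ q1 _ _ y W W'' hd hr =>
      obtain ⟨W', z, e, hs⟩ := ih x' (U ++ y) W'' q1 (fun z hz => hW z (by simp [hz])) hr
      refine ⟨W', z, by simpa using e, .trans (csg_step (Rl.mv U.isEmpty q x y q1 x' W2.isEmpty hd
        (hW _ (by simp))) (outc true U) (rc W2) (by simp [rc]) ?_) hs⟩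
      have hy := A.ne _ hd
      have : (U ++ y).isEmpty = false := by
        cases U <;> cases y <;> simp_all
      simp [outc_append, this]

theorem sim_back {A : FST (Symb M T) Q} {V : Set (Symb M T)} {hV : V.Finite} {s : M}
    (W1 : List (Symb M T)) (x : Symb M T) (W2 : List (Symb M T))
    (hW1 : ∀ z ∈ W1, z ∈ V) (hx : x ∈ V) :
    ∃ z W', W1 ++ x :: W2 = z :: W' ∧ Relation.ReflTransGen (simG A V hV s).Step
      (outc true W1 ++ cc x W1.isEmpty W2.isEmpty .back :: rc W2)
      (cc z true W'.isEmpty .back :: rc W') := by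
  induction W1 using List.reverseRecOn generalizing x W2 with
  | nil => exact ⟨x, W2, rfl, .refl⟩
  | append_singleton W1 y ih =>
    obtain ⟨z, W', e, hs⟩ := ih y (x :: W2) (fun z hz => hW1 z (by simp [hz]))
      (hW1 y (by simp))
    refine ⟨z, W', by simpa using e, .trans (csg_step (Rl.bk y W1.isEmpty x W2.isEmpty
      (hW1 y (by simp)) hx) (outc true W1) (rc W2) ?_ ?_) hs⟩
    · have : (W1 ++ [y]).isEmpty = false := by cases W1 <;> rfl
      simp [outc_snoc, this]
    · simp [rc]

theorem sim_fin {A : FST (Symb M T) Q} {V : Set (Symb M T)} {hV : V.Finite} {s : M}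
    (w : List T) (t : T) (l : Bool) (ts : List T)
    (ht : Sum.inr t ∈ V) (hW : ∀ t ∈ w, Sum.inr t ∈ V) :
    Relation.ReflTransGen (simG A V hV s).Step
      (ts.map Sum.inr ++ cc (Sum.inr t) l w.isEmpty .fin :: rc (w.map Sum.inr))
      ((ts ++ t :: w).map Sum.inr) := by
  induction w generalizing t l ts with
  | nil => exact csg_step (Rl.fnend t l ht) (ts.map Sum.inr) [] (by simp [rc]) (by simp)
  | cons t' w ih =>
    have := ih t' false (ts ++ [t]) (hW t' (by simp)) (fun z hz => hW z (by simp [hz]))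
    refine .trans (csg_step (Rl.fn t l (Sum.inr t') w.isEmpty ht (hW _ (by simp)))
      (ts.map Sum.inr) (rc (w.map Sum.inr)) (by simp [rc]) ?_) (by simpa using this)
    simp

theorem sim_complete {A : FST (Symb M T) Q} {V : Set (Symb M T)} {hV : V.Finite} {s : M}
    (hs : Sum.inl s ∈ V) (hδ : ∀ t ∈ A.δ, ∀ z ∈ t.2.2.1, z ∈ V)
    {w : List T} (h : Reach A s (w.map Sum.inr)) : w ∈ (simG A V hV s).Lang := by
  have key : ∀ W, Reach A s W → ∃ z W', W = z :: W' ∧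
      Relation.ReflTransGen (simG A V hV s).Step [Sum.inl (simG A V hV s).start]
        (cc z true W'.isEmpty .back :: rc W') := by
    intro W h
    induction h with
    | refl => exact ⟨Sum.inl s, [], rfl, .refl⟩
    | @tail W W' hW hsw ih =>
      obtain ⟨z, W1, rfl, hst⟩ := ih
      obtain ⟨q0, hq0, q, hq, hrun⟩ := hsw
      have hv := reach_V hs hδ hW
      have hv' : ∀ z ∈ W', z ∈ V := run_out hδ hrun
      obtain ⟨W2, y, e, hst2⟩ := sim_fwd (hV := hV) (s := s) W1 z [] W' q0 q
        (fun z hz => hv z (by simp [hz])) hq hrun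
      rw [List.nil_append] at e
      subst e
      obtain ⟨z', W3, e, hst3⟩ := sim_back (A := A) (hV := hV) (s := s) W2 y []
        (fun z hz => hv' z (by simp [hz])) (hv' y (by simp))
      refine ⟨z', W3, e, hst.trans (.trans (csg_step
        (Rl.start z W1.isEmpty q0 (hv z (by simp)) hq0) [] (rc W1) (by simp) ?_)
        (hst2.trans hst3))⟩
      simp [outc]
  obtain ⟨z, W', e, hst⟩ := key _ h
  have hv := reach_V hs hδ h
  cases w with
  | nil => simp at e
  | cons t w =>
    simp only [List.map_cons, List.cons.injEq] at e
    obtain ⟨rfl, rfl⟩ := e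
    refine hst.trans (.trans (csg_step (Rl.startfin (Sum.inr t) w.isEmpty (hv _ (by simp))) []
      (rc (w.map Sum.inr)) (by simp) rfl) ?_)
    have := sim_fin (A := A) (hV := hV) (s := s) w t true [] (hv _ (by simp))
      (fun t ht => hv _ (by simp [ht]))
    simpa using this

theorem fst_cs (A : FST (Symb M T) Q) (s : M) :
    {w : List T | Reach A s (w.map Sum.inr)} ∈ CS T := by
  let V : Set (Symb M T) := {Sum.inl s} ∪ ⋃ t ∈ A.δ, {z | z ∈ t.2.2.1}
  have hV : V.Finite := (Set.finite_singleton _).union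
    (A.fin.biUnion fun t _ => List.finite_toSet t.2.2.1)
  refine ⟨_, simG A V hV s, ?_⟩
  ext w
  refine ⟨sim_sound, sim_complete (by simp [V]) ?_⟩
  intro t ht z hz
  exact .inr (Set.mem_biUnion ht hz)

end


/-! ### Random context languages are context-sensitive -/

section
variable {N T : Type}

/-- The symbols occurring in a grammar. -/
def voc (G : RCG N T) : Set (Symb N T) :=
  {Sum.inl G.start} ∪ ⋃ r ∈ G.rules, {z | z ∈ r.2.1}

theorem voc_finite (G : RCG N T) : (voc G).Finite :=
  (Set.finite_singleton _).union (G.fin.biUnion fun t _ => List.finite_toSet t.2.1)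

abbrev RSt (N T : Type) := (N × List (Symb N T) × Set N × Set N) × Bool × Set (Symb N T)

inductive RTr (G : RCG N T) : RSt N T × Symb N T × List (Symb N T) × RSt N T → Prop
  | skip (r b S x) : r ∈ G.rules → S ⊆ voc G → x ∈ voc G → (∀ B ∈ r.2.2.2, Sum.inl B ≠ x) →
      RTr G ((r, b, S), x, [x], (r, b, insert x S))
  | app (r S) : r ∈ G.rules → S ⊆ voc G →
      RTr G ((r, false, S), Sum.inl r.1, r.2.1, (r, true, S))

def rcFST (G : RCG N T) : FST (Symb N T) (RSt N T) where
  δ := {t | RTr G t}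
  fin := by
    have h1 := voc_finite G
    have h2 : (𝒫 (voc G)).Finite := h1.finite_subsets
    have hB : (Set.univ : Set Bool).Finite := Set.finite_univ
    refine (((G.fin.prod (hB.prod (h2.prod h1))).image
      (fun p => (((p.1, p.2.1, p.2.2.1), p.2.2.2, [p.2.2.2],
        (p.1, p.2.1, insert p.2.2.2 p.2.2.1)) :
        RSt N T × Symb N T × List (Symb N T) × RSt N T))).union
      ((G.fin.prod h2).image
      (fun p => (((p.1, false, p.2), Sum.inl p.1.1, p.1.2.1, (p.1, true, p.2)) :
        RSt N T × Symb N T × List (Symb N T) × RSt N T)))).subset ?_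
    rintro t ht
    cases ht with
    | skip r b S x hr hS hx _ => exact .inl ⟨(r, b, S, x), ⟨hr, trivial, hS, hx⟩, rfl⟩
    | app r S hr hS => exact .inr ⟨(r, S), ⟨hr, hS⟩, rfl⟩
  ne := by
    rintro t ht
    cases ht with
    | skip => simp
    | app r S hr hS => exact G.ne r hr
  I := {q | q.1 ∈ G.rules ∧ q.2 = (false, ∅)}
  Ifin := by
    refine (G.fin.image (fun r => ((r, false, ∅) : RSt N T))).subset ?_
    rintro ⟨r, q⟩ ⟨h1, h2⟩
    exact ⟨r, h1, by simp at h2; simp [h2]⟩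
  F := {q | q.2.1 = true ∧ ∀ B ∈ q.1.2.2.1, Sum.inl B ∈ q.2.2}

theorem rc_run {G : RCG N T} {q q' : RSt N T} {W W' : List (Symb N T)}
    (h : (rcFST G).Run q W W' q') :
    q'.1 = q.1 ∧
    ((q'.2.1 = q.2.1 ∧ W' = W ∧ q'.2.2 = q.2.2 ∪ {x | x ∈ W} ∧ ∀ B ∈ q.1.2.2.2, Sum.inl B ∉ W) ∨
     (q.2.1 = false ∧ q'.2.1 = true ∧ q.1 ∈ G.rules ∧ ∃ u v, W = u ++ Sum.inl q.1.1 :: v ∧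
      W' = u ++ q.1.2.1 ++ v ∧ q'.2.2 = q.2.2 ∪ {x | x ∈ u ++ v} ∧
      ∀ B ∈ q.1.2.2.2, Sum.inl B ∉ u ++ v)) := by
  induction h with
  | nil q => simp
  | @cons q q1 q2 x y W W' hd hrn ih =>
    change RTr G _ at hd
    cases hd with
    | skip r b S _ hr hS hx hF =>
      obtain ⟨h0, ih⟩ := ih
      refine ⟨h0, ?_⟩
      rcases ih with ⟨h1, h2, h3, h4⟩ | ⟨h1, h2, h3, u, v, h4, h5, h6, h7⟩
      · refine .inl ⟨h1, by simp [h2], ?_, ?_⟩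
        · rw [h3]; ext z; simp; tauto
        · intro B hB hm
          rcases List.mem_cons.1 hm with hm | hm
          · exact hF B hB hm
          · exact h4 B hB hm
      · refine .inr ⟨h1, h2, h3, x :: u, v, by simp [h4], by simp [h5], ?_, ?_⟩
        · rw [h6]; ext z; simp; tauto
        · intro B hB hm
          rw [List.cons_append] at hm
          rcases List.mem_cons.1 hm with hm | hm
          · exact hF B hB hm
          · exact h7 B hB hm
    | app r S hr1 hS =>
      obtain ⟨h0, ih⟩ := ih
      refine ⟨h0, ?_⟩
      rcases ih with ⟨h1, h2, h3, h4⟩ | ⟨h1, h2, h3, u, v, h4, h5, h6, h7⟩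
      · exact .inr ⟨rfl, h1, hr1, [], W, by simp, by simp [h2], by simpa using h3, by simpa using h4⟩
      · simp at h1

theorem rc_skip {G : RCG N T} {r} (hr : r ∈ G.rules) (b : Bool) (S : Set (Symb N T))
    (hS : S ⊆ voc G) (W : List (Symb N T)) (hW : ∀ x ∈ W, x ∈ voc G)
    (hF : ∀ B ∈ r.2.2.2, Sum.inl B ∉ W) :
    (rcFST G).Run (r, b, S) W W (r, b, S ∪ {x | x ∈ W}) := by
  induction W generalizing S with
  | nil => simpa using FST.Run.nil _
  | cons x W ih =>
    have := ih (insert x S) (Set.insert_subset (hW x (by simp)) hS) (fun z hz => hW z (by simp [hz]))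
      (fun B hB hm => hF B hB (by simp [hm]))
    have e : insert x S ∪ {z | z ∈ W} = S ∪ {z | z ∈ x :: W} := by
      ext z; simp; tauto
    rw [e] at this
    exact FST.Run.cons (y := [x]) (RTr.skip r b S x hr hS (hW x (by simp))
      (fun B hB hm => hF B hB (by simp [hm]))) this

theorem rc_sweep_iff {G : RCG N T} {W W' : List (Symb N T)} (hW : ∀ x ∈ W, x ∈ voc G) :
    (rcFST G).Sweep W W' ↔ G.Step false W W' := by
  constructor
  · rintro ⟨⟨r, b, S⟩, ⟨h1, h2⟩, ⟨r', b', S'⟩, ⟨h3, h4⟩, hrun⟩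
    obtain ⟨e, h⟩ := rc_run hrun
    simp only [Prod.mk.injEq] at e h1 h2 h3 h4 h
    obtain ⟨rfl, rfl⟩ := h2
    subst e h3
    rcases h with ⟨h, _⟩ | ⟨_, _, _, u, v, rfl, rfl, rfl, h8⟩
    · simp at h
    · refine ⟨r'.1, r'.2.1, r'.2.2.1, r'.2.2.2, u, v, h1, rfl, rfl, ?_, ?_⟩
      · intro B hB; simpa [alph] using h4 B hB
      · intro B hB; simpa [alph] using h8 B hB
  · rintro ⟨A, x, Per, For, u, v, hr, rfl, rfl, h1, h2⟩
    simp only [alph, Bool.false_eq_true, if_false, Set.mem_ofPred_eq] at h1 h2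
    have hu := rc_skip hr false ∅ (Set.empty_subset _) u (fun x hx => hW x (by simp [hx]))
      (fun B hB hm => h2 B hB (by simp [hm]))
    have hS : ∅ ∪ {z | z ∈ u} ⊆ voc G := by
      intro z hz
      exact hW z (by simp at hz; simp [hz])
    have hv := rc_skip hr true _ hS v (fun x hx => hW x (by simp [hx]))
      (fun B hB hm => h2 B hB (by simp [hm]))
    refine ⟨((A, x, Per, For), false, ∅), ⟨hr, rfl⟩, ((A, x, Per, For), true, ∅ ∪ {z | z ∈ u} ∪ {z | z ∈ v}),
      ⟨rfl, ?_⟩, ?_⟩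
    rotate_left
    · rw [List.append_assoc]
      exact hu.append (FST.Run.cons (RTr.app _ _ hr hS) hv)
    · intro B hB
      simpa using h1 B hB

theorem step_voc {G : RCG N T} {b : Bool} {W W' : List (Symb N T)} (h : G.Step b W W')
    (hW : ∀ x ∈ W, x ∈ voc G) : ∀ x ∈ W', x ∈ voc G := by
  obtain ⟨A, x, Per, For, u, v, hr, rfl, rfl, h1, h2⟩ := h
  intro z hz
  simp only [List.mem_append] at hz
  rcases hz with (hz | hz) | hz
  · exact hW z (by simp [hz])
  · exact .inr (Set.mem_biUnion hr hz)
  · exact hW z (by simp [hz])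

theorem steps_voc {G : RCG N T} {b : Bool} {W : List (Symb N T)}
    (h : Relation.ReflTransGen (G.Step b) [Sum.inl G.start] W) : ∀ x ∈ W, x ∈ voc G := by
  induction h with
  | refl => simp [voc]
  | tail _ h ih => exact step_voc h ih

theorem rc_sub_cs (T : Type) : RC T ⊆ CS T := by
  rintro L ⟨N, G, rfl⟩
  have : G.Lang false = {w : List T | Reach (rcFST G) G.start (w.map Sum.inr)} := by
    ext w
    have h1 : ∀ W, Relation.ReflTransGen (G.Step false) [Sum.inl G.start] W →
        Reach (rcFST G) G.start W := by
      intro W h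
      induction h with
      | refl => exact .refl
      | tail h' h ih => exact ih.tail ((rc_sweep_iff (steps_voc h')).2 h)
    have h2 : ∀ W, Reach (rcFST G) G.start W →
        Relation.ReflTransGen (G.Step false) [Sum.inl G.start] W := by
      intro W h
      induction h with
      | refl => exact .refl
      | tail h' h ih => exact ih.tail ((rc_sweep_iff (steps_voc ih)).1 h)
    exact ⟨h1 _, h2 _⟩
  rw [this]
  exact fst_cs _ _

end

/-! ### The witness language -/

abbrev Tm := Option (Option Bool)

inductive Nt
  | S | D | pend (x : Option Bool)

instance : Finite Nt := by
  refine Finite.of_surjective (α := Option (Option (Option Bool)))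
    (fun a => match a with
      | none => Nt.S
      | some none => Nt.D
      | some (some x) => Nt.pend x) ?_
  rintro (_ | _ | x)
  · exact ⟨none, rfl⟩
  · exact ⟨some none, rfl⟩
  · exact ⟨some (some x), rfl⟩

inductive St
  | s | bit (β : Bool) | f | m0 | m1

instance : Finite St := by
  refine Finite.of_surjective (α := Option (Option (Option (Option Bool))))
    (fun a => match a with
      | none => St.s
      | some none => St.f
      | some (some none) => St.m0
      | some (some (some none)) => St.m1
      | some (some (some (some β))) => St.bit β) ?_
  rintro (_ | β | _ | _ | _)
  · exact ⟨none, rfl⟩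
  · exact ⟨some (some (some (some β))), rfl⟩
  · exact ⟨some none, rfl⟩
  · exact ⟨some (some none), rfl⟩
  · exact ⟨some (some (some none)), rfl⟩

abbrev Sy := Symb Nt Tm

abbrev sS : Sy := Sum.inl Nt.S
abbrev sD : Sy := Sum.inl Nt.D
abbrev sP (x : Option Bool) : Sy := Sum.inl (Nt.pend x)
abbrev sT (t : Tm) : Sy := Sum.inr t

inductive WTr : St × Sy × List Sy × St → Prop
  | sD : WTr (.s, sD, [sD], .s)
  | sS1 : WTr (.s, sS, [sD, sS], .s)
  | sS2 : WTr (.s, sS, [sD], .s)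
  | bD (β) : WTr (.bit β, sD, [sP (some β), sD], .bit β)
  | bP (β x) : WTr (.bit β, sP x, [sP x], .bit β)
  | fD : WTr (.f, sD, [sP none], .f)
  | fP (x) : WTr (.f, sP x, [sP x], .f)
  | m0T (t) : WTr (.m0, sT t, [sT t], .m0)
  | m0P (x) : WTr (.m0, sP x, [sT none, sT (some x)], .m1)
  | m1T : WTr (.m1, sT none, [sT none], .m1)
  | m1P (x) : WTr (.m1, sP x, [sT none, sP x], .m1)

theorem WTr_len {t} (h : WTr t) : t.2.2.1.length ≤ 2 := by
  cases h <;> simp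

def wFST : FST Sy St where
  δ := {t | WTr t}
  fin := by
    have h1 : {l : List Sy | l.length ≤ 2}.Finite := List.finite_length_le _ _
    have h2 : (Set.univ : Set St).Finite := Set.finite_univ
    have h3 : (Set.univ : Set Sy).Finite := Set.finite_univ
    refine (h2.prod (h3.prod (h1.prod h2))).subset ?_
    rintro t ht
    exact ⟨trivial, trivial, WTr_len ht, trivial⟩
  ne := by
    rintro t ht
    cases ht <;> simp
  I := {q | q ≠ .m1}
  Ifin := Set.toFinite _
  F := Set.univ

def markFrom : ℕ → List (Option Bool) → List Tm
  | _, [] => []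
  | i, x :: c => List.replicate i none ++ some x :: markFrom (i + 1) c

theorem markFrom_append (i : ℕ) (c d : List (Option Bool)) :
    markFrom i (c ++ d) = markFrom i c ++ markFrom (i + c.length) d := by
  induction c generalizing i with
  | nil => simp [markFrom]
  | cons x c ih => simp [markFrom, ih, Nat.add_comm, Nat.add_left_comm]

def blk (b : List Bool) (k : ℕ) : List (Option Bool) :=
  (List.replicate k (b.map some ++ [none])).flatten

def Wit : Set (List Tm) := {w | Reach wFST Nt.S (w.map Sum.inr)}

theorem wit_cs : Wit ∈ CS Tm := fst_cs _ _

theorem run_block {p : St → Prop} {x : Sy} (hc : ∀ q z y q', WTr (q, z, y, q') → p q → p q')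
    (hb : ∀ q y q', WTr (q, x, y, q') → ¬ p q) {q q' : St} {W W' : List Sy}
    (h : wFST.Run q W W' q') (hp : p q) : x ∉ W := by
  induction h with
  | nil => simp
  | cons hd _ ih =>
    change WTr _ at hd
    intro hm
    rcases List.mem_cons.1 hm with rfl | hm
    · exact hb _ _ _ hd hp
    · exact ih (hc _ _ _ _ hd hp) hm

theorem run_map {q q' : St} {W W' : List Sy} (g : Sy → List Sy)
    (h : wFST.Run q W W' q')
    (hc : ∀ x ∈ W, ∀ y q', WTr (q, x, y, q') → q' = q ∧ y = g x) : W' = W.flatMap g := by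
  induction h with
  | nil => simp
  | cons hd _ ih =>
    change WTr _ at hd
    obtain ⟨rfl, rfl⟩ := hc _ (by simp) _ _ hd
    rw [ih (fun x hx => hc x (by simp [hx]))]
    simp

theorem run_map' {q : St} (W : List Sy) (g : Sy → List Sy)
    (hc : ∀ x ∈ W, WTr (q, x, g x, q)) : wFST.Run q W (W.flatMap g) q := by
  induction W with
  | nil => exact .nil _
  | cons x W ih => exact .cons (hc x (by simp)) (ih fun z hz => hc z (by simp [hz]))

def gB (β : Bool) : Sy → List Sy
  | Sum.inl Nt.D => [sP (some β), sD]
  | x => [x]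

def gF : Sy → List Sy
  | Sum.inl Nt.D => [sP none]
  | x => [x]

def gM : Sy → List Sy
  | Sum.inl (Nt.pend x) => [sT none, sP x]
  | x => [x]

def F2 (b : List Bool) (k : ℕ) : List Sy :=
  (List.replicate k (b.map (fun β => sP (some β)) ++ [sD])).flatten

def F3 (c1 c2 : List (Option Bool)) : List Sy :=
  (markFrom 1 c1).map sT ++ c2.flatMap fun x => List.replicate c1.length (sT none) ++ [sP x]

theorem F2_gB (b k β) : (F2 b k).flatMap (gB β) = F2 (b ++ [β]) k := by
  have : ∀ b : List Bool, List.flatMap (gB β) (b.map (fun β => sP (some β))) =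
      b.map (fun β => sP (some β)) := by
    intro b
    induction b with
    | nil => rfl
    | cons a b ih => simp_all [gB]
  induction k with
  | zero => simp [F2]
  | succ k ih =>
    simp only [F2, List.replicate_succ, List.flatten_cons, List.flatMap_append] at ih ⊢
    rw [ih, this]
    simp [gB]

theorem F2_gF (b k) : (F2 b k).flatMap gF = F3 [] (blk b k) := by
  have : ∀ b : List Bool, List.flatMap gF (b.map (fun β => sP (some β))) =
      b.map (fun β => sP (some β)) := by
    intro b
    induction b with
    | nil => rfl
    | cons a b ih => simp_all [gF]
  induction k with
  | zero => simp [F2, F3, blk, markFrom]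
  | succ k ih =>
    simp only [F2, F3, blk, markFrom, List.replicate_succ, List.flatten_cons,
      List.flatMap_append] at ih ⊢
    rw [ih, this]
    simp [gF, List.flatMap_map]
    clear ih
    induction b <;> simp_all

theorem F3_step (c1 x c2) :
    F3 (c1 ++ [x]) c2 = (markFrom 1 c1).map sT ++ (List.replicate c1.length (sT none) ++
      ([sT none, sT (some x)] ++
        (c2.flatMap fun x => List.replicate c1.length (sT none) ++ [sP x]).flatMap gM)) := by
  have h : ∀ n x, (List.replicate n (sT none) ++ [sP x]).flatMap gM =
      List.replicate (n + 1) (sT none) ++ [sP x] := by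
    intro n x
    induction n with
    | zero => rfl
    | succ n ih =>
      rw [List.replicate_succ, List.cons_append, List.flatMap_cons, ih]
      rfl
  simp only [F3, markFrom_append, List.flatMap_assoc, h]
  simp [markFrom, Nat.add_comm 1, List.replicate_succ']

theorem run_m0 {ts : List Tm} {V W' : List Sy} {q : St}
    (h : wFST.Run .m0 (ts.map sT ++ V) W' q) :
    ∃ V', W' = ts.map sT ++ V' ∧ wFST.Run .m0 V V' q := by
  induction ts generalizing W' with
  | nil => exact ⟨W', by simp, by simpa using h⟩
  | cons t ts ih =>
    cases h with
    | cons hd h =>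
      change WTr _ at hd
      cases hd
      obtain ⟨V', rfl, h'⟩ := ih h
      exact ⟨V', by simp, h'⟩

theorem run_m0' (ts : List Tm) {V V' : List Sy} {q : St} (h : wFST.Run .m0 V V' q) :
    wFST.Run .m0 (ts.map sT ++ V) (ts.map sT ++ V') q := by
  induction ts with
  | nil => exact h
  | cons t ts ih =>
    have := FST.Run.cons (A := wFST) (WTr.m0T t) ih
    simpa using this

inductive WInv : List Sy → Prop
  | f1 (j) : WInv (List.replicate j sD ++ [sS])
  | f2 (b k) : WInv (F2 b k)
  | f3 (b k c1 c2) : c1 ++ c2 = blk b k → WInv (F3 c1 c2)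

theorem noS {W : List Sy} (hS : sS ∉ W) {W' q} (h : wFST.Run .s W W' q) : W' = W := by
  rw [run_map (fun x => [x]) h]
  · simp
  · intro x hx y q' ht
    cases ht
    · simp
    · exact absurd hx hS
    · exact absurd hx hS

theorem noDB {W : List Sy} {β} (hD : sD ∉ W) {W' q} (h : wFST.Run (.bit β) W W' q) : W' = W := by
  rw [run_map (fun x => [x]) h]
  · simp
  · intro x hx y q' ht
    cases ht
    · exact absurd hx hD
    · simp

theorem noDF {W : List Sy} (hD : sD ∉ W) {W' q} (h : wFST.Run .f W W' q) : W' = W := by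
  rw [run_map (fun x => [x]) h]
  · simp
  · intro x hx y q' ht
    cases ht
    · exact absurd hx hD
    · simp

theorem m_block {x : Sy} (hx : x = sS ∨ x = sD) {W W' q} (h : wFST.Run .m0 W W' q) : x ∉ W := by
  refine run_block (p := fun q => q = .m0 ∨ q = .m1) ?_ ?_ h (.inl rfl)
  · intro q z y q' ht hp
    cases ht <;> simp_all
  · intro q y q' ht hp
    rcases hx with rfl | rfl <;> cases ht <;> simp_all

theorem F2_D {b k} (h : sD ∉ F2 b k) : k = 0 := by
  cases k with
  | zero => rfl
  | succ k => simp [F2, List.replicate_succ] at h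

theorem F2_S {b k} : sS ∉ F2 b k := by
  simp [F2]

theorem F3_S {c d} : sS ∉ F3 c d := by
  simp [F3]

theorem F3_D {c d} : sD ∉ F3 c d := by
  simp [F3]

theorem inv_sweep {W W' : List Sy} (hI : WInv W) (h : wFST.Sweep W W') : WInv W' := by
  obtain ⟨q, hq, q', -, h⟩ := h
  cases hI with
  | f1 j =>
    cases q with
    | s =>
      have key : ∀ j W', wFST.Run .s (List.replicate j sD ++ [sS]) W' q' →
          W' = List.replicate (j + 1) sD ++ [sS] ∨ W' = List.replicate (j + 1) sD := by
        intro j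
        induction j with
        | zero =>
          intro W' h
          cases h with
          | cons hd h =>
            change WTr _ at hd
            cases h
            cases hd <;> simp
        | succ j ih =>
          intro W' h
          cases h with
          | cons hd h =>
            change WTr _ at hd
            cases hd
            rcases ih _ h with rfl | rfl
            · left; simp [List.replicate_succ]
            · right; simp [List.replicate_succ]
      rcases key _ _ h with rfl | rfl
      · exact .f1 _
      · have := WInv.f2 [] (j + 1)
        simpa [F2] using this
    | bit β =>
      exfalso
      refine run_block (p := fun q => q = .bit β) (x := sS) ?_ ?_ h rfl (by simp)
      · intro q z y q' ht hp
        cases ht <;> simp_all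
      · intro q y q' ht hp
        cases ht <;> simp_all
    | f =>
      exfalso
      refine run_block (p := fun q => q = .f) (x := sS) ?_ ?_ h rfl (by simp)
      · intro q z y q' ht hp
        cases ht <;> simp_all
      · intro q y q' ht hp
        cases ht <;> simp_all
    | m0 => exact absurd (by simp) (m_block (.inl rfl) h)
    | m1 => exact absurd rfl hq
  | f2 b k =>
    cases q with
    | s => rw [noS F2_S h]; exact .f2 b k
    | bit β =>
      rw [run_map (gB β) h, F2_gB]
      · exact .f2 _ _
      · intro x hx y q' ht
        cases ht <;> simp [gB]
    | f =>
      rw [run_map gF h, F2_gF]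
      · exact .f3 b k _ _ rfl
      · intro x hx y q' ht
        cases ht <;> simp [gF]
    | m0 =>
      obtain rfl := F2_D (m_block (.inr rfl) h)
      cases h
      exact .f2 b 0
    | m1 => exact absurd rfl hq
  | f3 b k c1 c2 e =>
    cases q with
    | s => rw [noS F3_S h]; exact .f3 b k _ _ e
    | bit β => rw [noDB F3_D h]; exact .f3 b k _ _ e
    | f => rw [noDF F3_D h]; exact .f3 b k _ _ e
    | m0 =>
      obtain ⟨V', rfl, h1⟩ := run_m0 h
      cases c2 with
      | nil =>
        cases h1
        exact .f3 b k _ [] e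
      | cons x c2 =>
        rw [List.flatMap_cons, List.append_assoc, ← List.map_replicate] at h1
        obtain ⟨V', rfl, h2⟩ := run_m0 h1
        rw [List.singleton_append] at h2
        cases h2 with
        | cons hd h3 =>
          change WTr _ at hd
          cases hd
          rw [run_map gM h3, List.map_replicate, ← F3_step]
          · exact .f3 b k _ _ (by simpa using e)
          · intro x hx y q' ht
            cases ht <;> simp [gM]
    | m1 => exact absurd rfl hq

theorem wit_sound {w : List Tm} (h : w ∈ Wit) : ∃ b k, w = markFrom 1 (blk b k) := by
  have hI : ∀ W, Reach wFST Nt.S W → WInv W := by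
    intro W h
    induction h with
    | refl => exact .f1 0
    | tail _ h ih => exact inv_sweep ih h
  have inj : Function.Injective (List.map sT) := List.map_injective_iff.2 Sum.inr_injective
  have := hI _ h
  generalize hW : w.map Sum.inr = W at this
  cases this with
  | f1 j =>
    have : sS ∈ w.map Sum.inr := by rw [hW]; simp
    simp at this
  | f2 b k =>
    have : sD ∉ F2 b k := by rw [← hW]; simp
    obtain rfl := F2_D this
    refine ⟨b, 0, ?_⟩
    simpa [F2, blk, markFrom] using hW
  | f3 b k c1 c2 e =>
    cases c2 with
    | nil =>
      refine ⟨b, k, inj ?_⟩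
      rw [← e]
      simpa [F3] using hW
    | cons x c2 =>
      have : sP x ∈ w.map Sum.inr := by rw [hW]; simp [F3]
      simp at this

theorem wit_complete (b : List Bool) (k : ℕ) : markFrom 1 (blk b (k + 1)) ∈ Wit := by
  have h1 : ∀ j, Reach wFST Nt.S (List.replicate j sD ++ [sS]) := by
    intro j
    induction j with
    | zero => exact .refl
    | succ j ih =>
      refine ih.tail ⟨.s, by simp [wFST], .s, trivial, ?_⟩
      have := (run_map' (q := .s) (List.replicate j sD) (fun x => [x]) (by
        intro x hx
        obtain rfl := List.eq_of_mem_replicate hx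
        exact .sD)).snoc WTr.sS1
      simpa [List.replicate_succ'] using this
  have h2 : Reach wFST Nt.S (F2 [] (k + 1)) := by
    refine (h1 k).tail ⟨.s, by simp [wFST], .s, trivial, ?_⟩
    have := (run_map' (q := .s) (List.replicate k sD) (fun x => [x]) (by
        intro x hx
        obtain rfl := List.eq_of_mem_replicate hx
        exact .sD)).snoc WTr.sS2
    simpa [F2, List.replicate_succ'] using this
  have hmem : ∀ b x, x ∈ F2 b (k + 1) → x = sD ∨ ∃ y, x = sP y := by
    intro b x hx
    simp only [F2, List.mem_flatten, List.mem_replicate] at hx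
    obtain ⟨l, ⟨-, rfl⟩, hx⟩ := hx
    simp only [List.mem_append, List.mem_map, List.mem_singleton] at hx
    rcases hx with ⟨β, -, rfl⟩ | rfl
    · exact .inr ⟨_, rfl⟩
    · exact .inl rfl
  have h3 : Reach wFST Nt.S (F2 b (k + 1)) := by
    induction b using List.reverseRecOn with
    | nil => exact h2
    | append_singleton b β ih =>
      refine ih.tail ⟨.bit β, by simp [wFST], .bit β, trivial, ?_⟩
      rw [← F2_gB]
      refine run_map' _ _ fun x hx => ?_
      rcases hmem _ _ hx with rfl | ⟨y, rfl⟩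
      · exact .bD β
      · exact .bP β y
  have h4 : Reach wFST Nt.S (F3 [] (blk b (k + 1))) := by
    refine h3.tail ⟨.f, by simp [wFST], .f, trivial, ?_⟩
    rw [← F2_gF]
    refine run_map' _ _ fun x hx => ?_
    rcases hmem _ _ hx with rfl | ⟨y, rfl⟩
    · exact .fD
    · exact .fP y
  have h5 : ∀ c1 c2, c1 ++ c2 = blk b (k + 1) → Reach wFST Nt.S (F3 c1 c2) := by
    intro c1
    induction c1 using List.reverseRecOn with
    | nil =>
      rintro c2 e
      rw [List.nil_append] at e
      rw [e]; exact h4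
    | append_singleton c1 x ih =>
      intro c2 e
      refine (ih (x :: c2) (by simpa using e)).tail ⟨.m0, by simp [wFST], .m1, trivial, ?_⟩
      rw [F3_step, F3, List.flatMap_cons, List.append_assoc, ← List.map_replicate]
      refine run_m0' _ (run_m0' _ ?_)
      refine FST.Run.cons (WTr.m0P x) ?_
      rw [List.map_replicate]
      refine run_map' _ _ fun z hz => ?_
      obtain ⟨y, -, hy⟩ := List.mem_flatMap.1 hz
      rcases List.mem_append.1 hy with hy | hy
      · obtain rfl := List.eq_of_mem_replicate hy
        exact .m1T
      obtain rfl := List.mem_singleton.1 hy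
      exact .m1P y
  have := h5 _ [] (List.append_nil _)
  simpa [F3, Wit] using this


/-! ### The exchange lemma for random context derivations -/

section
variable {N T : Type}

abbrev Ent (N T : Type) := Symb N T × List T

def wf (P : List (Ent N T)) : Prop := ∀ e ∈ P, ∀ t, e.1 = Sum.inr t → e.2 = [t]

def nts (P : List (Ent N T)) : List (Ent N T) := P.filter fun e => e.1.isLeft

def yl (P : List (Ent N T)) : List T := P.flatMap Prod.snd

abbrev Steps (G : RCG N T) := Relation.ReflTransGen (G.Step false)

def Good (G : RCG N T) (P : List (Ent N T)) : Prop :=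
  wf P ∧ ∀ P', wf P' → (nts P').Perm (nts P) → Steps G (P'.map Prod.fst) ((yl P').map Sum.inr)

@[simp] theorem nts_append (P Q : List (Ent N T)) : nts (P ++ Q) = nts P ++ nts Q := by
  simp [nts]

@[simp] theorem nts_cons_inl (A : N) (y : List T) (Q : List (Ent N T)) :
    nts ((Sum.inl A, y) :: Q) = (Sum.inl A, y) :: nts Q :=
  List.filter_cons_of_pos rfl

@[simp] theorem nts_cons_inr (t : T) (y : List T) (Q : List (Ent N T)) :
    nts ((Sum.inr t, y) :: Q) = nts Q := by
  simp [nts]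

@[simp] theorem nts_nil : nts ([] : List (Ent N T)) = [] := rfl

@[simp] theorem yl_append (P Q : List (Ent N T)) : yl (P ++ Q) = yl P ++ yl Q := by
  simp [yl]

@[simp] theorem yl_cons (e : Ent N T) (Q : List (Ent N T)) : yl (e :: Q) = e.2 ++ yl Q := by
  simp [yl]

@[simp] theorem yl_nil : yl ([] : List (Ent N T)) = [] := rfl

theorem wf_append {P Q : List (Ent N T)} : wf (P ++ Q) ↔ wf P ∧ wf Q := by
  simp only [wf, List.mem_append]
  constructor
  · exact fun h => ⟨fun e he => h e (.inl he), fun e he => h e (.inr he)⟩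
  · rintro ⟨h1, h2⟩ e (he | he)
    · exact h1 e he
    · exact h2 e he

theorem wf_cons {e : Ent N T} {Q : List (Ent N T)} :
    wf (e :: Q) ↔ (∀ t, e.1 = Sum.inr t → e.2 = [t]) ∧ wf Q := by
  simp [wf]

theorem mem_nts {P : List (Ent N T)} {e : Ent N T} : e ∈ nts P ↔ e ∈ P ∧ ∃ A, e.1 = Sum.inl A := by
  simp [nts, Sum.isLeft_iff]

theorem inl_mem {P : List (Ent N T)} {A : N} :
    Sum.inl A ∈ P.map Prod.fst ↔ ∃ y, (Sum.inl A, y) ∈ nts P := by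
  simp only [List.mem_map, mem_nts]
  constructor
  · rintro ⟨⟨a, y⟩, h, rfl⟩
    exact ⟨y, h, A, rfl⟩
  · rintro ⟨y, h, -⟩
    exact ⟨_, h, rfl⟩

theorem wf_nts_nil {P : List (Ent N T)} (hw : wf P) (h : nts P = []) :
    P.map Prod.fst = (yl P).map Sum.inr := by
  induction P with
  | nil => rfl
  | cons e P ih =>
    obtain ⟨a | t, y⟩ := e
    · simp at h
    · rw [wf_cons] at hw
      have := hw.1 t rfl
      simp only at this
      subst this
      simp at h
      simp [ih hw.2 h]

theorem good_term (G : RCG N T) (w : List T) :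
    Good G (w.map fun t => ((Sum.inr t : Symb N T), [t])) ∧
    nts (w.map fun t => ((Sum.inr t : Symb N T), [t])) = [] ∧
    yl (w.map fun t => ((Sum.inr t : Symb N T), [t])) = w := by
  have h1 : nts (w.map fun t => ((Sum.inr t : Symb N T), [t])) = [] := by
    simp [nts]
  refine ⟨⟨?_, ?_⟩, h1, ?_⟩
  · intro e he t
    obtain ⟨t', -, rfl⟩ := List.mem_map.1 he
    simp
  · intro P' hw hp
    rw [h1, List.perm_nil] at hp
    rw [wf_nts_nil hw hp]
  · induction w <;> simp_all [nts]

theorem good_step {G : RCG N T} {A : N} {x : List (Symb N T)} {Per For : Set N}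
    (hr : (A, x, Per, For) ∈ G.rules) {Pu Px Pv : List (Ent N T)}
    (hg : Good G (Pu ++ Px ++ Pv)) (hx : Px.map Prod.fst = x)
    (h1 : ∀ B ∈ Per, Sum.inl B ∈ (Pu ++ Pv).map Prod.fst)
    (h2 : ∀ B ∈ For, Sum.inl B ∉ (Pu ++ Pv).map Prod.fst) :
    Good G (Pu ++ (Sum.inl A, yl Px) :: Pv) := by
  obtain ⟨hw, hg⟩ := hg
  rw [wf_append, wf_append] at hw
  obtain ⟨⟨hwu, hwx⟩, hwv⟩ := hw
  refine ⟨?_, ?_⟩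
  · rw [wf_append, wf_cons]
    exact ⟨hwu, by simp, hwv⟩
  · intro P' hw' hp
    have hm : (Sum.inl A, yl Px) ∈ nts P' := by
      rw [hp.mem_iff]; simp
    obtain ⟨U, V, rfl⟩ := List.append_of_mem (mem_nts.1 hm).1
    have hp' : (nts (U ++ V)).Perm (nts (Pu ++ Pv)) := by
      rw [nts_append, nts_cons_inl, nts_append, nts_cons_inl] at hp
      rw [nts_append, nts_append]
      exact (List.perm_cons _).1 (List.perm_middle.symm.trans (hp.trans List.perm_middle))
    rw [wf_append, wf_cons] at hw'
    have key := hg (U ++ Px ++ V) (by rw [wf_append, wf_append]; exact ⟨⟨hw'.1, hwx⟩, hw'.2.2⟩) (by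
      rw [nts_append] at hp'
      simp only [nts_append] at hp' ⊢
      have e1 : (nts U ++ nts Px ++ nts V).Perm (nts Px ++ (nts U ++ nts V)) := by
        rw [← List.append_assoc]
        exact List.perm_append_comm.append_right _
      have e2 : (nts Pu ++ nts Px ++ nts Pv).Perm (nts Px ++ (nts Pu ++ nts Pv)) := by
        rw [← List.append_assoc]
        exact List.perm_append_comm.append_right _
      exact e1.trans ((hp'.append_left _).trans e2.symm))
    have hmem : ∀ B : N, Sum.inl B ∈ (U ++ V).map Prod.fst ↔ Sum.inl B ∈ (Pu ++ Pv).map Prod.fst := by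
      intro B
      simp only [inl_mem, hp'.mem_iff]
    refine Relation.ReflTransGen.head ?_ (by simpa using key)
    refine ⟨A, x, Per, For, U.map Prod.fst, V.map Prod.fst, hr, by simp, by simp [hx], ?_, ?_⟩
    · intro B hB
      have := (hmem B).2 (h1 B hB)
      simpa [alph] using this
    · intro B hB
      have := mt (hmem B).1 (h2 B hB)
      simpa [alph] using this

theorem steps_len {G : RCG N T} {α β : List (Symb N T)} (h : Steps G α β) :
    α.length ≤ β.length := by
  induction h with
  | refl => exact le_rfl
  | tail _ h ih =>
    obtain ⟨A, x, Per, For, u, v, hr, rfl, rfl, -, -⟩ := h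
    have := List.length_pos_iff.2 (G.ne _ hr)
    simp at *
    omega

theorem wt_sum {wt : List T → ℕ} (h0 : wt [] = 0) (ha : ∀ u v, wt (u ++ v) = wt u + wt v)
    (m : ℕ) (P : List (Ent N T)) (hP : ∀ e ∈ P, wt e.2 ≤ m) : wt (yl P) ≤ P.length * m := by
  induction P with
  | nil => simp [h0]
  | cons e P ih =>
    have := ih fun e he => hP e (by simp [he])
    have := hP e (by simp)
    simp [ha, Nat.succ_mul]
    omega

theorem threshold (G : RCG N T) {wt : List T → ℕ} (h0 : wt [] = 0)
    (ha : ∀ u v, wt (u ++ v) = wt u + wt v) (h1 : ∀ t, wt [t] ≤ 1) {m c0 : ℕ} (hm : 1 ≤ m)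
    (hc1 : 1 ≤ c0) (hc : ∀ r ∈ G.rules, r.2.1.length ≤ c0) {w : List T} {α : List (Symb N T)}
    (h : Steps G α (w.map Sum.inr)) :
    ∃ P, P.map Prod.fst = α ∧ yl P = w ∧ Good G P ∧ ((∀ e ∈ nts P, wt e.2 ≤ m) ∨
      ∃ Q, Steps G α (Q.map Prod.fst) ∧ yl Q = w ∧ Good G Q ∧ (∃ e ∈ nts Q, m < wt e.2) ∧
        ∀ e ∈ nts Q, wt e.2 ≤ c0 * m) := by
  induction h using Relation.ReflTransGen.head_induction_on with
  | refl =>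
    obtain ⟨g1, g2, g3⟩ := good_term G w
    refine ⟨_, ?_, g3, g1, .inl ?_⟩
    · simp
    · simp [g2]
  | head hs _ ih =>
    obtain ⟨Q, hQ, hy, hg, hor⟩ := ih
    have hs' := hs
    obtain ⟨A, x, Per, For, u, v, hr, rfl, rfl, hper, hfor⟩ := hs
    obtain ⟨Pux, Pv, rfl, hux, hv⟩ := List.map_eq_append_iff.1 hQ
    obtain ⟨Pu, Px, rfl, hu, hx⟩ := List.map_eq_append_iff.1 hux
    have hgP : Good G (Pu ++ (Sum.inl A, yl Px) :: Pv) := by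
      refine good_step hr hg hx ?_ ?_
      · intro B hB
        have := hper B hB
        simpa [alph, ← hu, ← hv] using this
      · intro B hB
        have := hfor B hB
        simpa [alph, ← hu, ← hv] using this
    have hfst : (Pu ++ (Sum.inl A, yl Px) :: Pv).map Prod.fst = u ++ Sum.inl A :: v := by
      simp [hu, hv]
    have hyl : yl (Pu ++ (Sum.inl A, yl Px) :: Pv) = w := by
      rw [← hy]; simp
    refine ⟨Pu ++ (Sum.inl A, yl Px) :: Pv, hfst, hyl, hgP, ?_⟩
    rcases hor with hor | ⟨Q, hQ1, hQ2⟩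
    · have hPx : wt (yl Px) ≤ c0 * m := by
        refine (wt_sum h0 ha m Px ?_).trans (Nat.mul_le_mul_right m ?_)
        · intro e he
          obtain ⟨a | t, y⟩ := e
          · exact hor _ (by simp [mem_nts, he])
          · have hw := hg.1
            rw [wf_append, wf_append] at hw
            have := hw.1.2 _ he t rfl
            simp only at this
            rw [this]
            exact (h1 t).trans hm
        · have := hc _ hr
          rw [← hx] at this
          simpa using this
      have hother : ∀ e ∈ nts (Pu ++ (Sum.inl A, yl Px) :: Pv), e = (Sum.inl A, yl Px) ∨ wt e.2 ≤ m := by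
        intro e he
        rw [nts_append, nts_cons_inl, List.mem_append, List.mem_cons] at he
        rcases he with he | he | he
        · exact .inr (hor e (by simp [he]))
        · exact .inl he
        · exact .inr (hor e (by simp [he]))
      by_cases hle : wt (yl Px) ≤ m
      · left
        intro e he
        rcases hother e he with rfl | h
        · exact hle
        · exact h
      · right
        refine ⟨Pu ++ (Sum.inl A, yl Px) :: Pv, ?_, hyl, hgP, ⟨(Sum.inl A, yl Px), by simp,
          by simpa using hle⟩, ?_⟩
        · rw [hfst]
        · intro e he
          rcases hother e he with rfl | h
          · exact hPx
          · exact h.trans (Nat.le_mul_of_pos_left m hc1)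
    · exact .inr ⟨Q, hQ1.head hs', hQ2⟩

end


/-! ### Combinatorics of the marked words -/

def hh (w : List Tm) : List (Option Bool) := w.filterMap id

@[simp] theorem hh_append (u v : List Tm) : hh (u ++ v) = hh u ++ hh v := by simp [hh]
@[simp] theorem hh_nil : hh [] = [] := rfl
@[simp] theorem hh_none (u : List Tm) : hh (none :: u) = hh u := rfl
@[simp] theorem hh_some (x) (u : List Tm) : hh (some x :: u) = x :: hh u := rfl
@[simp] theorem hh_rep (n : ℕ) : hh (List.replicate n none) = [] := by
  induction n <;> simp_all [List.replicate_succ]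

@[simp] theorem hh_mark (i : ℕ) (c) : hh (markFrom i c) = c := by
  induction c generalizing i with
  | nil => rfl
  | cons x c ih => simp [markFrom, ih]

theorem mark_len (i : ℕ) (c) : (markFrom i c).length ≤ c.length * (i + c.length) := by
  induction c generalizing i with
  | nil => simp [markFrom]
  | cons x c ih =>
    have := ih (i + 1)
    simp [markFrom]
    nlinarith

theorem rep_split {n j : ℕ} {x y : Option Bool} {u v : List Tm}
    (h : List.replicate n none ++ some x :: u = List.replicate j none ++ some y :: v) :
    n = j ∧ x = y ∧ u = v := by
  induction n generalizing j with
  | zero => cases j <;> simp_all [List.replicate_succ]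
  | succ n ih =>
    cases j with
    | zero => simp [List.replicate_succ] at h
    | succ j =>
      simp only [List.replicate_succ, List.cons_append, List.cons.injEq, true_and] at h
      have h' := ih h
      exact ⟨by omega, h'.2⟩

theorem hh_decomp {v : List Tm} {x c} (h : hh v = x :: c) :
    ∃ n v', v = List.replicate n none ++ some x :: v' ∧ hh v' = c := by
  induction v with
  | nil => simp at h
  | cons a v ih =>
    cases a with
    | none =>
      obtain ⟨n, v', rfl, h'⟩ := ih h
      exact ⟨n + 1, v', by simp [List.replicate_succ], h'⟩
    | some a =>
      simp at h
      exact ⟨0, v, by simp [h.1], h.2⟩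

theorem mark_split {i : ℕ} {c} {p q : List Tm} {x} (h : markFrom i c = p ++ some x :: q) :
    ∃ c2, q = markFrom (i + (hh p).length + 1) c2 := by
  induction c generalizing i p with
  | nil => simp [markFrom] at h
  | cons a c ih =>
    rw [markFrom] at h
    cases hp : hh p with
    | nil =>
      have : ∃ n, p = List.replicate n none := by
        refine ⟨p.length, List.eq_replicate_iff.2 ⟨rfl, ?_⟩⟩
        intro b hb
        rcases b with _ | b
        · rfl
        · have : b ∈ hh p := by simpa [hh] using hb
          rw [hp] at this
          simp at this
      obtain ⟨n, rfl⟩ := this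
      obtain ⟨-, -, rfl⟩ := rep_split h
      exact ⟨c, by simp⟩
    | cons y d =>
      obtain ⟨n, p', rfl, rfl⟩ := hh_decomp hp
      rw [List.append_assoc, List.cons_append] at h
      obtain ⟨-, -, h⟩ := rep_split h
      obtain ⟨c2, rfl⟩ := ih h
      refine ⟨c2, ?_⟩
      congr 1
      simp
      omega

theorem mark_unique {c c' : List (Option Bool)} {s v t s' t' : List Tm}
    (h : markFrom 1 c = s ++ v ++ t) (h' : markFrom 1 c' = s' ++ v ++ t')
    (hv : 2 ≤ (hh v).length) : (hh s).length = (hh s').length := by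
  match e : hh v, hv with
  | x :: y :: d, _ =>
    obtain ⟨n, v1, rfl, e1⟩ := hh_decomp e
    obtain ⟨l, v2, rfl, e2⟩ := hh_decomp e1
    have key : ∀ {c s t}, markFrom 1 c = s ++ (List.replicate n none ++ some x ::
        (List.replicate l none ++ some y :: v2)) ++ t → l = (hh s).length + 2 := by
      intro c s t h
      have h : markFrom 1 c = (s ++ List.replicate n none) ++ some x ::
        (List.replicate l none ++ some y :: (v2 ++ t)) := by
        rw [h]; simp
      obtain ⟨c2, h⟩ := mark_split h
      cases c2 with
      | nil => simp [markFrom] at h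
      | cons z c2 =>
        rw [markFrom] at h
        obtain ⟨rfl, -⟩ := rep_split h
        simp
        omega
    have h1 := key h
    have h2 := key h'
    omega

theorem blk_len (b k) : (blk b k).length = k * (b.length + 1) := by
  simp [blk]

theorem blk_get (b : List Bool) (k q : ℕ) (h : q < k * (b.length + 1)) :
    (blk b k)[q]? = (b.map some ++ [none])[q % (b.length + 1)]? := by
  induction k generalizing q with
  | zero => simp at h
  | succ k ih =>
    rw [blk, List.replicate_succ, List.flatten_cons]
    rcases lt_or_ge q (b.length + 1) with hq | hq
    · rw [List.getElem?_append_left (by simpa using hq), Nat.mod_eq_of_lt hq]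
    · rw [List.getElem?_append_right (by simpa using hq), Nat.mod_eq_sub_mod hq]
      have := ih (q - (b.length + 1)) (by rw [Nat.succ_mul] at h; omega)
      rw [← this, blk]
      simp

theorem blk_bit {b : List Bool} {k q : ℕ} (h : q < k * (b.length + 1))
    (hq : q % (b.length + 1) < b.length) :
    (blk b k)[q]? = some (some b[q % (b.length + 1)]) := by
  rw [blk_get b k q h, List.getElem?_append_left (by simpa using hq)]
  simp [hq]

theorem blk_dol {b : List Bool} {k q : ℕ} (h : q < k * (b.length + 1))
    (hq : q % (b.length + 1) = b.length) :
    (blk b k)[q]? = some none := by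
  rw [blk_get b k q h, hq]
  simp

theorem blk_mod {b : List Bool} {k q : ℕ} (h : (blk b k)[q]? = some none) :
    q % (b.length + 1) = b.length := by
  have hq : q < k * (b.length + 1) := by
    have := (List.getElem?_eq_some_iff.1 h).1
    rwa [blk_len] at this
  by_contra hne
  have : q % (b.length + 1) < b.length := by
    have := Nat.mod_lt q (Nat.add_one_pos b.length)
    omega
  rw [blk_bit hq this] at h
  simp at h

/-- The final combinatorial contradiction. -/
theorem comb {F : Type} [Fintype F] {m k c0 : ℕ} {b1 b2 b3 : List Bool} {k3 : ℕ}
    (hb1 : b1.length = m) (hb2 : b2.length = m) (hne : b1 ≠ b2)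
    (hk : Fintype.card F * c0 < k) (hlen : (blk b3 k3).length = k * (m + 1))
    (K : F → ℕ → ℕ → Prop) (huniq : ∀ A s e s' e', K A s e → K A s' e' → s = s')
    (hsmall : ∀ A s e, K A s e → e ≤ c0 * m)
    (hbound : ∀ A s e, K A s e → s + e ≤ k * (m + 1))
    (hbig : ∃ A s e, K A s e ∧ m < e)
    (hin : ∀ q < k * (m + 1), (∃ A s e, K A s e ∧ s ≤ q ∧ q < s + e) →
      (blk b3 k3)[q]? = (blk b2 k)[q]?)
    (hout : ∀ q < k * (m + 1), (¬ ∃ A s e, K A s e ∧ s ≤ q ∧ q < s + e) →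
      (blk b3 k3)[q]? = (blk b1 k)[q]?) : False := by
  have hk1 : m < k * (m + 1) := by
    have : 1 * (m + 1) ≤ k * (m + 1) := Nat.mul_le_mul_right _ (by omega)
    omega
  have hor : ∀ q < k * (m + 1), (blk b3 k3)[q]? = (blk b2 k)[q]? ∨
      (blk b3 k3)[q]? = (blk b1 k)[q]? := by
    intro q hq
    by_cases h : ∃ A s e, K A s e ∧ s ≤ q ∧ q < s + e
    · exact .inl (hin q hq h)
    · exact .inr (hout q hq h)
  have hlen' := hlen
  rw [blk_len] at hlen'
  have hdol : ∀ q, (blk b3 k3)[q]? = some none → q < k * (m + 1) → q % (m + 1) = m := by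
    intro q h hq
    rcases hor q hq with h' | h'
    · rw [h] at h'
      have := blk_mod h'.symm
      rwa [hb2] at this
    · rw [h] at h'
      have := blk_mod h'.symm
      rwa [hb1] at this
  have hb3 : b3.length = m := by
    have h1 : (blk b3 k3)[m]? = some none := by
      rcases hor m hk1 with h | h
      · rw [h]; exact blk_dol (by rwa [hb2]) (by simp [hb2])
      · rw [h]; exact blk_dol (by rwa [hb1]) (by simp [hb1])
    have h2 := blk_mod h1
    rcases lt_trichotomy b3.length m with hlt | heq | hgt
    · have h3 : (blk b3 k3)[b3.length]? = some none := by
        refine blk_dol ?_ (by simp)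
        rw [hlen']
        omega
      have := hdol _ h3 (by omega)
      rw [Nat.mod_eq_of_lt (by omega)] at this
      omega
    · exact heq
    · rw [Nat.mod_eq_of_lt (by omega)] at h2
      omega
  obtain ⟨p, hp, hpne⟩ : ∃ p, ∃ h : p < m, b1[p] ≠ b2[p] := by
    by_contra hcon
    push Not at hcon
    exact hne (List.ext_getElem (by omega) fun i h1 h2 => hcon i (by omega))
  -- the value inside a long interval
  have e2 : b3[p] = b2[p] := by
    obtain ⟨A, s, e, hK, he⟩ := hbig
    obtain ⟨q, hq1, hq2, hq3⟩ : ∃ q, s ≤ q ∧ q < s + e ∧ q % (m + 1) = p := by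
      refine ⟨s + (p + (m + 1) - s % (m + 1)) % (m + 1), by omega, ?_, ?_⟩
      · have := Nat.mod_lt (p + (m + 1) - s % (m + 1)) (Nat.add_one_pos m)
        omega
      · have h1 := Nat.mod_lt s (Nat.add_one_pos m)
        rw [Nat.add_mod, Nat.mod_mod, ← Nat.add_mod]
        have h2 := Nat.div_add_mod s (m + 1)
        have : s + (p + (m + 1) - s % (m + 1)) = p + (m + 1) * (s / (m + 1) + 1) := by
          rw [Nat.mul_add]; omega
        rw [this, Nat.add_mul_mod_self_left, Nat.mod_eq_of_lt (by omega)]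
    have hqM : q < k * (m + 1) := by
      have := hbound A s e hK
      omega
    have h := hin q hqM ⟨A, s, e, hK, hq1, hq2⟩
    rw [blk_bit (b := b3) (by rw [hlen']; exact hqM) (by rw [hb3, hq3]; exact hp),
      blk_bit (b := b2) (by rw [hb2]; exact hqM) (by rw [hb2, hq3]; exact hp)] at h
    simpa [hb3, hb2, hq3] using h
  have e1 : b3[p] = b1[p] := by
    obtain ⟨j, hj, hjn⟩ : ∃ j, j < k ∧ ¬ ∃ A s e, K A s e ∧ s ≤ p + j * (m + 1) ∧
        p + j * (m + 1) < s + e := by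
      by_contra hcon
      push Not at hcon
      choose A s e hK h1 h2 using fun j : Fin k => hcon j j.2
      have hlt : ∀ j : Fin k, (p + j * (m + 1) - s j) / (m + 1) < c0 := by
        intro j
        rw [Nat.div_lt_iff_lt_mul (Nat.add_one_pos m)]
        have h3 := hsmall _ _ _ (hK j)
        have h4 := h1 j
        have h5 := h2 j
        have : c0 * m ≤ c0 * (m + 1) := Nat.mul_le_mul_left _ (by omega)
        omega
      have hinj : Function.Injective (fun j : Fin k =>
          ((A j, ⟨(p + j * (m + 1) - s j) / (m + 1), hlt j⟩) : F × Fin c0)) := by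
        intro j j' hjj
        simp only [Prod.mk.injEq, Fin.mk.injEq] at hjj
        obtain ⟨hA, hq⟩ := hjj
        have hs : s j = s j' := huniq (A j) _ _ _ _ (hK j) (hA ▸ hK j')
        have a1 := h1 j
        have a2 := h1 j'
        rw [← hs] at hq a2
        have d1 := Nat.div_add_mod (p + j * (m + 1) - s j) (m + 1)
        have d2 := Nat.div_add_mod (p + j' * (m + 1) - s j) (m + 1)
        have m1 := Nat.mod_lt (p + j * (m + 1) - s j) (Nat.add_one_pos m)
        have m2 := Nat.mod_lt (p + j' * (m + 1) - s j) (Nat.add_one_pos m)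
        rw [← hq] at d2
        ext
        rcases lt_trichotomy (j : ℕ) j' with h | h | h
        · have : (j + 1) * (m + 1) ≤ j' * (m + 1) := Nat.mul_le_mul_right _ h
          rw [Nat.add_mul] at this
          omega
        · exact h
        · have : (j' + 1) * (m + 1) ≤ j * (m + 1) := Nat.mul_le_mul_right _ h
          rw [Nat.add_mul] at this
          omega
      have := Fintype.card_le_of_injective _ hinj
      simp at this
      omega
    have hqM : p + j * (m + 1) < k * (m + 1) := by
      have : (j + 1) * (m + 1) ≤ k * (m + 1) := Nat.mul_le_mul_right _ hj
      rw [Nat.add_mul] at this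
      omega
    have hq3 : (p + j * (m + 1)) % (m + 1) = p := by
      rw [Nat.add_mul_mod_self_right, Nat.mod_eq_of_lt (by omega)]
    have h := hout _ hqM hjn
    rw [blk_bit (b := b3) (by rw [hlen']; exact hqM) (by rw [hb3, hq3]; exact hp),
      blk_bit (b := b1) (by rw [hb1]; exact hqM) (by rw [hb1, hq3]; exact hp)] at h
    simpa [hb3, hb1, hq3] using h
  exact hpne (e1.symm.trans e2)

theorem poly_exp (k r : ℕ) : ∃ m, 1 ≤ m ∧
    ((k * (m + 1) * (1 + k * (m + 1)) + 1) ^ 4 *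
      ((k * (m + 1) * (1 + k * (m + 1)) + 1) ^ 2 + 1)) ^ r < 2 ^ m := by
  have hb : ∀ m : ℕ, ((k * (m + 1) * (1 + k * (m + 1)) + 1) ^ 4 *
      ((k * (m + 1) * (1 + k * (m + 1)) + 1) ^ 2 + 1)) ^ r ≤
      (k + 2) ^ (12 * r) * (m + 1) ^ (12 * r) := by
    intro m
    rw [← mul_pow, pow_mul]
    refine Nat.pow_le_pow_left ?_ r
    set X := (k + 2) * (m + 1) with hX
    set Y := k * (m + 1) with hY
    have h1 : Y + 2 ≤ X := by
      rw [hX, hY]; nlinarith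
    have h2 : Y * (1 + Y) + 2 ≤ X ^ 2 := by nlinarith
    have h3 : Y * (1 + Y) + 1 ≤ X ^ 2 := by omega
    have h4 : (Y * (1 + Y) + 1) ^ 2 + 1 ≤ (X ^ 2) ^ 2 := by
      generalize Y * (1 + Y) = Z at *
      have : (Z + 2) ^ 2 ≤ (X ^ 2) ^ 2 := Nat.pow_le_pow_left h2 2
      nlinarith
    calc _ ≤ (X ^ 2) ^ 4 * (X ^ 2) ^ 2 := Nat.mul_le_mul (Nat.pow_le_pow_left h3 4) h4
      _ = X ^ 12 := by ring
  set C := (k + 2) ^ (12 * r) with hC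
  have hCpos : (0 : ℝ) < C := by
    rw [hC]; positivity
  have ht := tendsto_pow_const_div_const_pow_of_one_lt (12 * r) (r := (2 : ℝ)) (by norm_num)
  have hev := ht.eventually (gt_mem_nhds (show (0 : ℝ) < 1 / (2 * C) by positivity))
  obtain ⟨n, hn, hn2⟩ := (hev.and (Filter.eventually_ge_atTop 2)).exists
  obtain ⟨m, rfl⟩ : ∃ m, n = m + 1 := ⟨n - 1, by omega⟩
  refine ⟨m, by omega, (hb m).trans_lt ?_⟩
  rw [div_lt_div_iff₀ (by positivity) (by positivity), one_mul, pow_succ] at hn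
  have : (C : ℝ) * ((m + 1 : ℕ) : ℝ) ^ (12 * r) < 2 ^ m := by linarith
  exact_mod_cast this


/-! ### Keys of decompositions -/

section
variable {N : Type}

abbrev KK (N : Type) := N × (Option (Option Bool) ⊕ (ℕ × ℕ))

def skA (i n : ℕ) : List (Option Bool) → Option (Option Bool) ⊕ (ℕ × ℕ)
  | [] => Sum.inl none
  | [x] => Sum.inl (some x)
  | _ :: _ :: _ => Sum.inr (i, n)

def sk (i : ℕ) (y : List Tm) : Option (Option Bool) ⊕ (ℕ × ℕ) := skA i (hh y).length (hh y)

theorem sk_inr {i y s e} : sk i y = Sum.inr (s, e) ↔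
    i = s ∧ (hh y).length = e ∧ 2 ≤ (hh y).length := by
  unfold sk
  match hh y with
  | [] => simp [skA]
  | [x] => simp [skA]
  | _ :: _ :: _ => simp [skA]

theorem sk_inl {i y x j y'} (h : sk i y = Sum.inl x) (h' : sk j y' = Sum.inl x) : hh y = hh y' := by
  unfold sk at h h'
  revert h h'
  match hh y, hh y' with
  | [], [] => simp
  | [], [x] => simp only [skA]; intro h h'; simp [← h] at h'
  | [], _ :: _ :: _ => simp [skA]
  | [x], [] => simp only [skA]; intro h h'; simp [← h] at h'
  | [x], [y] => simp only [skA]; intro h h'; simp [← h] at h'; simp [h']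
  | [x], _ :: _ :: _ => simp [skA]
  | _ :: _ :: _, _ => simp [skA]

def dk : ℕ → List (Ent N Tm) → List (KK N × Ent N Tm)
  | _, [] => []
  | i, (Sum.inl A, y) :: Q => ((A, sk i y), (Sum.inl A, y)) :: dk (i + (hh y).length) Q
  | i, (Sum.inr _, y) :: Q => dk (i + (hh y).length) Q

def ks (i : ℕ) (Q : List (Ent N Tm)) : List (KK N) := (dk i Q).map Prod.fst

theorem dk_snd (i : ℕ) (Q : List (Ent N Tm)) : (dk i Q).map Prod.snd = nts Q := by
  induction Q generalizing i with
  | nil => rfl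
  | cons e Q ih =>
    obtain ⟨a | t, y⟩ := e
    · rw [nts_cons_inl]; simp [dk, ih]
    · rw [nts_cons_inr]; simp [dk, ih]

theorem mem_dk {i : ℕ} {Q : List (Ent N Tm)} {x} (h : x ∈ dk i Q) :
    ∃ U A y V, Q = U ++ (Sum.inl A, y) :: V ∧
      x = ((A, sk (i + (hh (yl U)).length) y), (Sum.inl A, y)) := by
  induction Q generalizing i with
  | nil => simp [dk] at h
  | cons e Q ih =>
    obtain ⟨a | t, y⟩ := e
    · rw [dk, List.mem_cons] at h
      rcases h with rfl | h
      · exact ⟨[], a, y, Q, rfl, by simp⟩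
      · obtain ⟨U, A, z, V, rfl, rfl⟩ := ih h
        exact ⟨(Sum.inl a, y) :: U, A, z, V, rfl, by simp [Nat.add_assoc]⟩
    · rw [dk] at h
      obtain ⟨U, A, z, V, rfl, rfl⟩ := ih h
      exact ⟨(Sum.inr t, y) :: U, A, z, V, rfl, by simp [Nat.add_assoc]⟩

theorem mem_ks {i : ℕ} {Q : List (Ent N Tm)} {x} (h : x ∈ ks i Q) :
    ∃ U A y V, Q = U ++ (Sum.inl A, y) :: V ∧ x = (A, sk (i + (hh (yl U)).length) y) := by
  obtain ⟨z, hz, rfl⟩ := List.mem_map.1 h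
  obtain ⟨U, A, y, V, h1, rfl⟩ := mem_dk hz
  exact ⟨U, A, y, V, h1, rfl⟩

theorem big_ks {i : ℕ} {Q : List (Ent N Tm)} {A s e} (h : (A, Sum.inr (s, e)) ∈ ks i Q) :
    ∃ U y V, Q = U ++ (Sum.inl A, y) :: V ∧ s = i + (hh (yl U)).length ∧ e = (hh y).length ∧
      2 ≤ (hh y).length := by
  obtain ⟨U, B, y, V, rfl, hx⟩ := mem_ks h
  rw [Prod.mk.injEq] at hx
  obtain ⟨rfl, hx⟩ := hx
  obtain ⟨h1, h2, h3⟩ := sk_inr.1 hx.symm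
  exact ⟨U, y, V, rfl, h1.symm, h2.symm, h3⟩

theorem ks_of_mem {Q : List (Ent N Tm)} {A y} (i : ℕ) (h : (Sum.inl A, y) ∈ Q) :
    ∃ j, (A, sk j y) ∈ ks i Q := by
  have : (Sum.inl A, y) ∈ (dk i Q).map Prod.snd := by
    rw [dk_snd, mem_nts]
    exact ⟨h, A, rfl⟩
  obtain ⟨x, hx, he⟩ := List.mem_map.1 this
  have hx' := hx
  obtain ⟨U, B, z, V, -, rfl⟩ := mem_dk hx
  simp only [Prod.mk.injEq, Sum.inl.injEq] at he
  obtain ⟨rfl, rfl⟩ := he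
  exact ⟨_, List.mem_map.2 ⟨_, hx', rfl⟩⟩

def cov (i : ℕ) (Q : List (Ent N Tm)) (q : ℕ) : Prop :=
  ∃ A s e, (A, Sum.inr (s, e)) ∈ ks i Q ∧ s ≤ q ∧ q < s + e

theorem fill (c2 : List (Option Bool)) (Q : List (Ent N Tm)) (hQ : wf Q) (i : ℕ)
    (L : List (KK N × Ent N Tm))
    (hL : ∀ x ∈ L, ∃ A y s, x = ((A, sk s y), (Sum.inl A, y)) ∧
      ∀ j < (hh y).length, (hh y)[j]? = c2[s + j]?)
    (hk : L.map Prod.fst = ks i Q) :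
    ∃ P, P.map Prod.fst = Q.map Prod.fst ∧ nts P = L.map Prod.snd ∧ wf P ∧
      (hh (yl P)).length = (hh (yl Q)).length ∧
      ∀ q < (hh (yl Q)).length, (cov i Q (i + q) → (hh (yl P))[q]? = c2[i + q]?) ∧
        (¬ cov i Q (i + q) → (hh (yl P))[q]? = (hh (yl Q))[q]?) := by
  induction Q generalizing i L with
  | nil =>
    simp [ks, dk] at hk
    subst hk
    exact ⟨[], rfl, rfl, by simp [wf], rfl, by simp⟩
  | cons e Q ih =>
    rw [wf_cons] at hQ
    obtain ⟨a | t, y⟩ := e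
    · have hks : ks i ((Sum.inl a, y) :: Q) = (a, sk i y) :: ks (i + (hh y).length) Q := rfl
      rw [hks] at hk
      obtain ⟨x, L, rfl, hx, hk⟩ := List.map_eq_cons_iff.1 hk
      obtain ⟨P, p1, p2, p3, p4, p5⟩ := ih hQ.2 _ L (fun x hx => hL x (by simp [hx])) hk
      obtain ⟨A, z, s, rfl, hz⟩ := hL x (by simp)
      simp only [Prod.mk.injEq] at hx
      obtain ⟨rfl, hx⟩ := hx
      have hcov : ∀ q, cov i ((Sum.inl A, y) :: Q) q ↔
          ((2 ≤ (hh y).length ∧ i ≤ q ∧ q < i + (hh y).length) ∨ cov (i + (hh y).length) Q q) := by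
        intro q
        simp only [cov, hks, List.mem_cons]
        constructor
        · rintro ⟨B, s, e, h | h, h1, h2⟩
          · rw [Prod.mk.injEq] at h
            obtain ⟨rfl, rfl, h4⟩ := sk_inr.1 h.2.symm
            exact .inl ⟨h4, h1, h2⟩
          · exact .inr ⟨B, s, e, h, h1, h2⟩
        · rintro (⟨h1, h2, h3⟩ | ⟨B, s, e, h, h1, h2⟩)
          · exact ⟨A, i, (hh y).length, .inl (by rw [sk_inr.2 ⟨rfl, rfl, h1⟩]), h2, h3⟩
          · exact ⟨B, s, e, .inr h, h1, h2⟩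
      have hge : ∀ q, cov (i + (hh y).length) Q q → i + (hh y).length ≤ q := by
        rintro q ⟨B, s, e, h, h1, h2⟩
        obtain ⟨U, _, _, -, rfl, -⟩ := big_ks h
        omega
      have hlen : (hh z).length = (hh y).length ∧ (2 ≤ (hh y).length → s = i) ∧
          (¬ 2 ≤ (hh y).length → hh z = hh y) := by
        rcases h : sk i y with x | ⟨s', e'⟩
        · have := sk_inl (hx.trans h) h
          refine ⟨by rw [this], ?_, fun _ => this⟩
          intro h2
          rw [sk_inr.2 ⟨rfl, rfl, h2⟩] at h
          simp at h
        · obtain ⟨h1, h2, h3⟩ := sk_inr.1 h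
          obtain ⟨h4, h5, h6⟩ := sk_inr.1 (hx.trans h)
          exact ⟨h5.trans h2.symm, fun _ => h4.trans h1.symm, fun h => absurd h3 h⟩
      obtain ⟨l1, l2, l3⟩ := hlen
      refine ⟨(Sum.inl A, z) :: P, by simp [p1], ?_, ?_, by simp [l1, p4], ?_⟩
      · rw [nts_cons_inl]; simp [p2]
      · rw [wf_cons]; exact ⟨by simp, p3⟩
      · intro q hq
        simp only [yl_cons, hh_append, List.length_append] at hq ⊢
        rw [hcov]
        rcases lt_or_ge q (hh y).length with hlt | hle
        · rw [List.getElem?_append_left (by omega), List.getElem?_append_left hlt]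
          constructor
          · rintro (⟨h2, -, -⟩ | h)
            · rw [hz _ (by omega), l2 h2]
            · have := hge _ h
              omega
          · intro h
            rw [l3]
            intro h2
            exact h (.inl ⟨h2, by omega, by omega⟩)
        · rw [List.getElem?_append_right (by omega), List.getElem?_append_right hle, l1]
          have := p5 (q - (hh y).length) (by omega)
          rw [show i + (hh y).length + (q - (hh y).length) = i + q by omega] at this
          constructor
          · rintro (⟨-, -, h⟩ | h)
            · omega
            · exact this.1 h
          · intro h
            exact this.2 fun h' => h (.inr h')
    · have hks : ks i ((Sum.inr t, y) :: Q) = ks (i + (hh y).length) Q := rfl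
      rw [hks] at hk
      obtain ⟨P, p1, p2, p3, p4, p5⟩ := ih hQ.2 _ L hL hk
      have hge : ∀ q, cov (i + (hh y).length) Q q → i + (hh y).length ≤ q := by
        rintro q ⟨B, s, e, h, h1, h2⟩
        obtain ⟨U, _, _, -, rfl, -⟩ := big_ks h
        omega
      refine ⟨(Sum.inr t, y) :: P, by simp [p1], ?_, ?_, by simp [p4], ?_⟩
      · rw [nts_cons_inr]; simp [p2]
      · rw [wf_cons]; exact ⟨hQ.1, p3⟩
      · intro q hq
        simp only [yl_cons, hh_append, List.length_append] at hq ⊢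
        change (cov (i + (hh y).length) Q (i + q) → _) ∧ (¬ cov (i + (hh y).length) Q (i + q) → _)
        rcases lt_or_ge q (hh y).length with hlt | hle
        · rw [List.getElem?_append_left (by omega), List.getElem?_append_left hlt]
          refine ⟨fun h => ?_, fun _ => rfl⟩
          have := hge _ h
          omega
        · rw [List.getElem?_append_right (by omega), List.getElem?_append_right hle]
          have := p5 (q - (hh y).length) (by omega)
          rwa [show i + (hh y).length + (q - (hh y).length) = i + q by omega] at this

theorem perm_map_lift {α β : Type} (f : α → β) {l : List α} {k : List β} (h : k.Perm (l.map f)) :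
    ∃ l' : List α, l'.Perm l ∧ l'.map f = k := by
  obtain ⟨l', h1, h2⟩ := List.perm_comp_forall₂ (r := fun b a => b = f a) h
    (List.forall₂_map_left_iff.2 (List.forall₂_same.2 fun _ _ => rfl))
  refine ⟨l', h2, ?_⟩
  clear h h2
  induction h1 with
  | nil => rfl
  | cons h _ ih => simp [h, ih]

noncomputable instance kkBEq : BEq (KK N) := @instBEqOfDecidableEq _ (Classical.decEq _)

instance kkLawful : LawfulBEq (KK N) where
  eq_of_beq h := @of_decide_eq_true _ (Classical.decEq _ _ _) h
  rfl {a} := @decide_eq_true (a = a) (Classical.decEq _ _ _) rfl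

def RR (x y : KK N) : Prop := ∀ A p p', x = (A, Sum.inr p) → y = (A, Sum.inr p') → False

theorem RR_unique {l : List (KK N)} (h : l.Pairwise RR) {A p p'}
    (h1 : (A, Sum.inr p) ∈ l) (h2 : (A, Sum.inr p') ∈ l) : p = p' := by
  by_contra hne
  have hs : ∀ x y : KK N, RR x y → RR y x := fun x y hxy A p p' e1 e2 => hxy A p' p e2 e1
  have : Std.Symm (RR (N := N)) := ⟨hs⟩
  have := h.forall h1 h2 (by simpa using hne)
  exact this A p p' rfl rfl

theorem RR_count {l : List (KK N)} (h : l.Pairwise RR) {A p} (h1 : (A, Sum.inr p) ∈ l) :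
    l.count (A, Sum.inr p) = 1 := by
  refine le_antisymm ?_ (List.count_pos_iff.2 h1)
  by_contra hcon
  have h2 : 2 ≤ l.count (A, Sum.inr p) := by omega
  have := h.sublist (List.replicate_sublist_iff.2 h2)
  simp [List.replicate_succ] at this
  exact this A p p rfl rfl

open Classical in
noncomputable def bigOf (l : List (KK N)) (A : N) : Option (ℕ × ℕ) :=
  if h : ∃ p, (A, Sum.inr p) ∈ l then some h.choose else none

theorem bigOf_iff {l : List (KK N)} (h : l.Pairwise RR) {A p} :
    bigOf l A = some p ↔ (A, Sum.inr p) ∈ l := by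
  unfold bigOf
  split_ifs with hex
  · rw [Option.some.injEq]
    constructor
    · rintro rfl; exact hex.choose_spec
    · intro h'; exact RR_unique h hex.choose_spec h'
  · simp only [false_iff]
    exact fun h' => hex ⟨p, h'⟩

abbrev DT (B : ℕ) := (Option (Option Bool) → Fin (B + 1)) × Option (Fin (B + 1) × Fin (B + 1))

noncomputable def dataOf (B : ℕ) (l : List (KK N)) (A : N) : DT B :=
  (fun x => Fin.ofNat (B + 1) (l.count (A, Sum.inl x)),
    (bigOf l A).map fun p => (Fin.ofNat (B + 1) p.1, Fin.ofNat (B + 1) p.2))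

theorem ofNat_inj {B a b : ℕ} (ha : a ≤ B) (hb : b ≤ B)
    (h : Fin.ofNat (B + 1) a = Fin.ofNat (B + 1) b) : a = b := by
  have := congrArg Fin.val h
  simp only [Fin.ofNat] at this
  rwa [Nat.mod_eq_of_lt (by omega), Nat.mod_eq_of_lt (by omega)] at this

theorem data_perm {B : ℕ} {V : Set N} {l l' : List (KK N)} (h : l.Pairwise RR)
    (h' : l'.Pairwise RR) (hB : l.length ≤ B) (hB' : l'.length ≤ B)
    (hV : ∀ x ∈ l, x.1 ∈ V) (hV' : ∀ x ∈ l', x.1 ∈ V)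
    (hp : ∀ A p, (A, Sum.inr p) ∈ l → p.1 ≤ B ∧ p.2 ≤ B)
    (hp' : ∀ A p, (A, Sum.inr p) ∈ l' → p.1 ≤ B ∧ p.2 ≤ B)
    (hd : ∀ A ∈ V, dataOf B l A = dataOf B l' A) : l.Perm l' := by
  rw [List.perm_iff_count]
  rintro ⟨A, x⟩
  by_cases hA : A ∈ V
  swap
  · rw [List.count_eq_zero_of_not_mem fun hm => hA (hV (A, x) hm),
      List.count_eq_zero_of_not_mem fun hm => hA (hV' (A, x) hm)]
  have := hd A hA
  simp only [dataOf, Prod.mk.injEq] at this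
  obtain ⟨d1, d2⟩ := this
  rcases x with x | p
  · exact ofNat_inj (List.count_le_length.trans hB) (List.count_le_length.trans hB') (congrFun d1 x)
  · have hmem : (A, Sum.inr p) ∈ l ↔ (A, Sum.inr p) ∈ l' := by
      rw [← bigOf_iff h, ← bigOf_iff h']
      have hb : ∀ p, bigOf l A = some p → p.1 ≤ B ∧ p.2 ≤ B := fun p hh => hp A p ((bigOf_iff h).1 hh)
      have hb' : ∀ p, bigOf l' A = some p → p.1 ≤ B ∧ p.2 ≤ B :=
        fun p hh => hp' A p ((bigOf_iff h').1 hh)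
      rcases e : bigOf l A with _ | a <;> rcases e' : bigOf l' A with _ | a'
      · rfl
      · simp [e, e'] at d2
      · simp [e, e'] at d2
      · simp only [e, e', Option.map_some, Option.some.injEq, Prod.mk.injEq] at d2
        have : a = a' := Prod.ext (ofNat_inj (hb _ e).1 (hb' _ e').1 d2.1)
          (ofNat_inj (hb _ e).2 (hb' _ e').2 d2.2)
        rw [this]
    by_cases hm : (A, Sum.inr p) ∈ l
    · rw [RR_count h hm, RR_count h' (hmem.1 hm)]
    · rw [List.count_eq_zero_of_not_mem hm, List.count_eq_zero_of_not_mem (mt hmem.2 hm)]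

/-- A nonterminal has at most one long yield. -/
theorem pairwise_ks {G : RCG N Tm} (hG : G.Lang false = Wit) {Q : List (Ent N Tm)}
    (hs : Steps G [Sum.inl G.start] (Q.map Prod.fst)) (hg : Good G Q) :
    (ks 0 Q).Pairwise RR := by
  have hin : ∀ P, P.map Prod.fst = Q.map Prod.fst → wf P → (nts P).Perm (nts Q) →
      ∃ b k, yl P = markFrom 1 (blk b k) := by
    intro P h1 h2 h3
    apply wit_sound
    rw [← hG]
    exact hs.trans (h1 ▸ hg.2 P h2 h3)
  have key : ∀ U V i, Q = U ++ V → (ks i V).Pairwise RR := by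
    intro U V
    induction V generalizing U with
    | nil => intro i _; exact List.Pairwise.nil
    | cons e V ih =>
      intro i hQ
      have ih' := fun j => ih (U ++ [e]) j (by simpa using hQ)
      obtain ⟨a | t, y⟩ := e
      · change ((a, sk i y) :: ks (i + (hh y).length) V).Pairwise RR
        rw [List.pairwise_cons]
        refine ⟨?_, ih' _⟩
        rintro x hx A ⟨s, l⟩ ⟨s', l'⟩ e1 rfl
        rw [Prod.mk.injEq] at e1
        obtain ⟨rfl, e1⟩ := e1
        obtain ⟨-, -, h2⟩ := sk_inr.1 e1
        obtain ⟨Z, y', V', rfl, -, -, h2'⟩ := big_ks hx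
        obtain ⟨b, k, hbk⟩ := hin Q rfl hg.1 (List.Perm.refl _)
        have hw := hg.1
        rw [hQ, wf_append, wf_cons, wf_append, wf_cons] at hw
        obtain ⟨b', k', hbk'⟩ := hin (U ++ (Sum.inl a, y') :: (Z ++ (Sum.inl a, y) :: V'))
          (by simp [hQ])
          (by
            rw [wf_append, wf_cons, wf_append, wf_cons]
            exact ⟨hw.1, by simp, hw.2.2.1, by simp, hw.2.2.2.2⟩)
          (by
            rw [hQ]
            simp only [nts_append, nts_cons_inl]
            refine List.Perm.append_left _ ?_
            refine ((List.perm_middle).cons _).trans ?_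
            refine (List.Perm.swap _ _ _).trans ?_
            exact (List.perm_middle.symm).cons _)
        rw [hQ] at hbk
        simp only [yl_append, yl_cons] at hbk hbk'
        have := mark_unique (s := yl U) (v := y) (t := yl Z ++ (y' ++ yl V'))
          (s' := yl U ++ y' ++ yl Z) (t' := yl V')
          (by rw [← hbk]; simp) (by rw [← hbk']; simp) h2
        simp only [hh_append, List.length_append] at this
        omega
      · exact ih' _
  exact key [] Q 0 rfl

theorem wit_not_rc : Wit ∉ RC Tm := by
  classical
  rintro ⟨N, G, hG⟩
  set V : Set N := {A | Sum.inl A ∈ voc G} with hVdef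
  have hVfin : V.Finite := (voc_finite G).preimage (Sum.inl_injective.injOn)
  let _ : Fintype V := hVfin.fintype
  obtain ⟨c0, hc1, hc⟩ : ∃ c0, 1 ≤ c0 ∧ ∀ r ∈ G.rules, r.2.1.length ≤ c0 := by
    obtain ⟨c, hc⟩ := (G.fin.image fun r => r.2.1.length).bddAbove
    exact ⟨c + 1, by omega, fun r hr => (hc ⟨r, hr, rfl⟩).trans (by omega)⟩
  set k := Fintype.card V * c0 + 1 with hk
  obtain ⟨m, hm, hcard⟩ := poly_exp k (Fintype.card V)
  set M := k * (m + 1) with hM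
  set B := M * (1 + M) with hB
  have hget : ∀ b : List.Vector Bool m, ∃ Q : List (Ent N Tm),
      Steps G [Sum.inl G.start] (Q.map Prod.fst) ∧
      yl Q = markFrom 1 (blk b.1 k) ∧ Good G Q ∧ (∃ e ∈ nts Q, m < (hh e.2).length) ∧
        ∀ e ∈ nts Q, (hh e.2).length ≤ c0 * m := by
    intro b
    have hw : Steps G [Sum.inl G.start] ((markFrom 1 (blk b.1 k)).map Sum.inr) := by
      have := wit_complete b.1 (Fintype.card V * c0)
      rw [← hG] at this
      exact this
    obtain ⟨P, h1, h2, h3, h4⟩ := threshold G (wt := fun y => (hh y).length) (by simp) (by simp)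
      (by
        rintro (_ | t)
        · simp
        · simp) hm hc1 hc hw
    rcases h4 with h4 | ⟨Q, h5, h6, h7, h8, h9⟩
    · exfalso
      obtain ⟨e, P', rfl, he, hP'⟩ := List.map_eq_cons_iff.1 h1
      rw [List.map_eq_nil_iff] at hP'
      subst hP'
      have h5 := h4 e (by rw [mem_nts]; exact ⟨by simp, _, he⟩)
      have h6 := congrArg (fun y => (hh y).length) h2
      simp only [yl_cons, yl_nil, List.append_nil, hh_mark, blk_len] at h6
      have : 1 * (m + 1) ≤ k * (b.1.length + 1) := Nat.mul_le_mul (by omega) (by rw [b.2])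
      omega
    · exact ⟨Q, h5, h6, h7, h8, h9⟩
  choose Q q1 q2 q3 q4 q5 using hget
  have hpw := fun b => pairwise_ks hG (q1 b) (q3 b)
  have hlenc : ∀ b : List.Vector Bool m, (blk b.1 k).length = M := by
    intro b
    rw [blk_len, b.2]
  have hhy : ∀ b, hh (yl (Q b)) = blk b.1 k := by
    intro b
    rw [q2, hh_mark]
  have hlenQ : ∀ b, (ks 0 (Q b)).length ≤ B := by
    intro b
    have h1 := steps_len ((q3 b).2 (Q b) (q3 b).1 (List.Perm.refl _))
    rw [List.length_map, List.length_map, q2] at h1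
    have h2 := mark_len 1 (blk b.1 k)
    rw [hlenc] at h2
    have h3 : (ks 0 (Q b)).length ≤ (Q b).length := by
      have := congrArg List.length (dk_snd 0 (Q b))
      rw [List.length_map] at this
      rw [ks, List.length_map, this]
      exact List.length_filter_le _ _
    omega
  have hVks : ∀ b, ∀ x ∈ ks 0 (Q b), x.1 ∈ V := by
    intro b x hx
    obtain ⟨U, A, y, W, hQ, rfl⟩ := mem_ks hx
    exact steps_voc (q1 b) (Sum.inl A) (by rw [hQ]; simp)
  have hbd : ∀ b A s e, (A, Sum.inr (s, e)) ∈ ks 0 (Q b) → s + e ≤ M := by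
    intro b A s e h
    obtain ⟨U, y, W, hQ, rfl, rfl, -⟩ := big_ks h
    have := congrArg List.length (hhy b)
    rw [hlenc, hQ] at this
    simp at this
    omega
  have hMB : M ≤ B := by
    rw [hB]; nlinarith
  -- pigeonhole
  obtain ⟨b1, b2, hne, hd⟩ := Fintype.exists_ne_map_eq_of_card_lt
    (fun (b : List.Vector Bool m) (A : V) => dataOf B (ks 0 (Q b)) A) (by
      simp only [Fintype.card_fun, Fintype.card_prod, Fintype.card_option, Fintype.card_fin,
        Fintype.card_bool, card_vector]
      refine lt_of_eq_of_lt ?_ hcard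
      congr 1
      rw [pow_two])
  have hperm : (ks 0 (Q b1)).Perm (ks 0 (Q b2)) := by
    refine data_perm (B := B) (V := V) (hpw b1) (hpw b2) (hlenQ b1) (hlenQ b2) (hVks b1) (hVks b2)
      ?_ ?_ ?_
    · rintro A ⟨s, e⟩ h
      have := hbd _ _ _ _ h
      constructor <;> simp <;> omega
    · rintro A ⟨s, e⟩ h
      have := hbd _ _ _ _ h
      constructor <;> simp <;> omega
    · intro A hA
      exact congrFun hd ⟨A, hA⟩
  obtain ⟨L, hL1, hL2⟩ := perm_map_lift Prod.fst hperm
  obtain ⟨P, p1, p2, p3, p4, p5⟩ := fill (blk b2.1 k) (Q b1) (q3 b1).1 0 L (by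
    intro x hx
    rw [hL1.mem_iff] at hx
    obtain ⟨U, A, y, W, hQ, rfl⟩ := mem_dk hx
    refine ⟨A, y, _, rfl, ?_⟩
    intro j hj
    rw [← hhy, hQ]
    simp only [yl_append, yl_cons, hh_append, Nat.zero_add]
    rw [List.getElem?_append_right (by omega), List.getElem?_append_left (by omega)]
    congr 1
    omega) hL2
  obtain ⟨b3, k3, h3⟩ : ∃ b k, yl P = markFrom 1 (blk b k) := by
    apply wit_sound
    rw [← hG]
    refine (q1 b1).trans ?_
    rw [← p1]
    refine (q3 b2).2 P p3 ?_
    rw [p2, ← dk_snd 0 (Q b2)]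
    exact hL1.map _
  have h3' : hh (yl P) = blk b3 k3 := by rw [h3, hh_mark]
  rw [h3', hhy, hlenc] at p4
  rw [h3', hhy, hlenc] at p5
  refine comb (F := V) (m := m) (k := k) (c0 := c0) b1.2 b2.2 (fun h => hne (Subtype.ext h))
    (by omega) p4 (fun A s e => ((A : N), Sum.inr (s, e)) ∈ ks 0 (Q b1)) ?_ ?_ ?_ ?_ ?_ ?_
  · intro A s e s' e' h h'
    exact congrArg Prod.fst (RR_unique (hpw b1) h h')
  · intro A s e h
    obtain ⟨U, y, W, hQ, -, rfl, -⟩ := big_ks h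
    exact q5 b1 (Sum.inl A, y) (by rw [hQ]; simp)
  · intro A s e h
    exact hbd _ _ _ _ h
  · obtain ⟨⟨x, y⟩, he, hlt⟩ := q4 b1
    obtain ⟨hmem, A, rfl⟩ := mem_nts.1 he
    obtain ⟨j, hj⟩ := ks_of_mem 0 hmem
    simp only at hlt
    rw [sk_inr.2 ⟨rfl, rfl, by omega⟩] at hj
    exact ⟨⟨A, hVks _ _ hj⟩, j, _, hj, hlt⟩
  · rintro q hq ⟨A, s, e, h⟩
    have := (p5 q hq).1
    rw [Nat.zero_add] at this
    exact this ⟨A, s, e, h⟩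
  · rintro q hq hn
    have := (p5 q hq).2
    rw [Nat.zero_add] at this
    refine this ?_
    rintro ⟨A, s, e, h, h'⟩
    exact hn ⟨⟨A, hVks _ _ h⟩, s, e, h, h'⟩

end


end RCP

/-- RC ⊊ CS: every random context language is context-sensitive,
and some context-sensitive language is not a random context language. -/
theorem rc_proper_subset_cs :
    (∀ T : Type, RC T ⊆ CS T) ∧
    (∃ (T : Type) (L : Set (List T)), L ∈ CS T ∧ L ∉ RC T) :=
  ⟨RCP.rc_sub_cs, RCP.Tm, RCP.Wit, RCP.wit_cs, RCP.wit_not_rc⟩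
end
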